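/- Assume (SH), (H1) and φ ∈ C¹(ℝⁿ). Given (t,x) ∈ [0,T]×ℝⁿ and a vector p̄ = (p̄_t, p̄_x) ∈ ∂*V(t,x)∖{0}, there exists at least one pair (y(·),p(·)) on [t,T] satisfying y'(s) = ∇ₚH(y(s),p(s)) for all s ∈ [t,T], −p'(s) ∈ ∂ₓ⁻H(y(s),p(s)) a.e. in [t,T], with initial conditions y(t)=x and p(t) = −p̄_x, and such that y(·) is optimal for the Mayer problem P(t,x). -/

import Mathlib

open MeasureTheory Filter Metric Set Topology
open scoped RealInnerProductSpace ENNReal NNReal Pointwise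

noncomputable section

variable {E : Type*} [NormedAddCommGroup E] [InnerProductSpace ℝ E] [CompleteSpace E]

/-- The Hamiltonian `H(x,p) = sup_{v ∈ F x} ⟪v,p⟫` associated with `F`. -/
def Ham (F : E → Set E) (x p : E) : ℝ :=
  sSup ((fun v => ⟪v, p⟫) '' F x)

/-- Standing hypotheses (SH): nonempty convex compact values, local Lipschitz continuity
with respect to the Hausdorff metric, and sublinear growth. -/
def StandingHyp (F : E → Set E) : Prop :=
  (∀ x, (F x).Nonempty ∧ Convex ℝ (F x) ∧ IsCompact (F x)) ∧
  (∀ x : E, ∃ ε > (0:ℝ), ∃ c : ℝ, 0 ≤ c ∧ ∀ y ∈ ball x ε, ∀ z ∈ ball x ε,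
    EMetric.hausdorffEdist (F y) (F z) ≤ ENNReal.ofReal (c * dist y z)) ∧
  (∃ r > (0:ℝ), ∀ x : E, ∀ v ∈ F x, ‖v‖ ≤ r * (1 + ‖x‖))

/-- `f` is semiconvex on `K` with constant `c`. -/
def SemiconvexWith (f : E → ℝ) (K : Set E) (c : ℝ) : Prop :=
  ∀ x h : E, x + h ∈ K → x - h ∈ K → -(c * ‖h‖ ^ 2) ≤ f (x + h) + f (x - h) - 2 * f x

/-- `f` is semiconcave on `K` with constant `c`. -/
def SemiconcaveWith (f : E → ℝ) (K : Set E) (c : ℝ) : Prop :=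
  ∀ x h : E, x + h ∈ K → x - h ∈ K → f (x + h) + f (x - h) - 2 * f x ≤ c * ‖h‖ ^ 2

def LocSemiconcave (f : E → ℝ) : Prop :=
  ∀ x : E, ∃ ε > (0:ℝ), ∃ c : ℝ, SemiconcaveWith f (ball x ε) c

def LocSemiconvex (f : E → ℝ) : Prop :=
  ∀ x : E, ∃ ε > (0:ℝ), ∃ c : ℝ, SemiconvexWith f (ball x ε) c

open scoped Classical in
/-- The gradient `∇ₚH(x,p)` of `H(x,·)` at `p` (junk value `0` if it does not exist). -/
def gradpH (F : E → Set E) (x p : E) : E :=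
  if h : ∃ g, HasGradientAt (fun q => Ham F x q) g p then h.choose else 0

/-- Hypothesis (H1): semiconvexity of `H(·,p)` with constant `c‖p‖` on compact convex sets,
existence of `∇ₚH(x,p)` for `p ≠ 0`, and local Lipschitz continuity of `x ↦ ∇ₚH(x,p)`,
uniformly for `p` in compact subsets of `ℝⁿ ∖ {0}`. -/
def HypH1 (F : E → Set E) : Prop :=
  (∀ K : Set E, K.Nonempty → Convex ℝ K → IsCompact K →
    ∃ c : ℝ, 0 ≤ c ∧ ∀ p : E, SemiconvexWith (fun x => Ham F x p) K (c * ‖p‖)) ∧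
  (∀ x p : E, p ≠ 0 → HasGradientAt (fun q => Ham F x q) (gradpH F x p) p) ∧
  (∀ K : Set E, K.Nonempty → Convex ℝ K → IsCompact K →
    ∀ P : Set E, IsCompact P → (0:E) ∉ P →
      ∃ L : ℝ≥0, ∀ p ∈ P, LipschitzOnWith L (fun x => gradpH F x p) K)

/-- Fréchet subdifferential `∂⁻f(x)`. -/
def FSub (f : E → ℝ) (x : E) : Set E :=
  {p | ∀ ε > (0:ℝ), ∀ᶠ y in 𝓝 x, -(ε * ‖y - x‖) ≤ f y - f x - ⟪p, y - x⟫}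

/-- Fréchet superdifferential `∂⁺f(x)`. -/
def FSuper (f : E → ℝ) (x : E) : Set E :=
  {p | ∀ ε > (0:ℝ), ∀ᶠ y in 𝓝 x, f y - f x - ⟪p, y - x⟫ ≤ ε * ‖y - x‖}

/-- Proximal superdifferential `∂^{+,pr}f(x)`. -/
def ProxSuper (f : E → ℝ) (x : E) : Set E :=
  {p | ∃ c : ℝ, 0 ≤ c ∧ ∃ ρ > (0:ℝ), ∀ y ∈ closedBall x ρ,
    f y - f x - ⟪p, y - x⟫ ≤ c * ‖y - x‖ ^ 2}

/-- Clarke's generalized gradient of `f` at `x`: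
`ζ ∈ ∂f(x)` iff `⟪ζ,v⟫ ≤ limsup_{y→x, h→0⁺} (f(y+hv)-f(y))/h` for all `v`. -/
def ClarkeGrad (f : E → ℝ) (x : E) : Set E :=
  {ζ | ∀ v : E, ∀ ε > (0:ℝ),
    ∃ᶠ q : E × ℝ in (𝓝 x) ×ˢ (𝓝[>] (0:ℝ)),
      ⟪ζ, v⟫ - ε ≤ (f (q.1 + q.2 • v) - f q.1) / q.2}

/-- `x` is absolutely continuous on `[t0,T]` with (a.e.) derivative `x'`. -/
def ACArc (t0 T : ℝ) (x x' : ℝ → E) : Prop :=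
  IntervalIntegrable x' volume t0 T ∧
  (∀ s ∈ Icc t0 T, x s = x t0 + ∫ r in t0..s, x' r) ∧
  (∀ᵐ s ∂volume, s ∈ Icc t0 T → HasDerivAt x (x' s) s)

/-- `x` is a trajectory of the differential inclusion `x' ∈ F(x)` on `[t0,T]`. -/
def IsTraj (F : E → Set E) (t0 T : ℝ) (x x' : ℝ → E) : Prop :=
  ACArc t0 T x x' ∧ ∀ᵐ s ∂volume, s ∈ Icc t0 T → x' s ∈ F (x s)

/-- `x` is an optimal trajectory for the Mayer problem `P(t0,x0)`. -/
def IsOptimal (F : E → Set E) (φ : E → ℝ) (t0 T : ℝ) (x0 : E) (x x' : ℝ → E) : Prop :=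
  IsTraj F t0 T x x' ∧ x t0 = x0 ∧
  ∀ y y' : ℝ → E, IsTraj F t0 T y y' → y t0 = x0 → φ (x T) ≤ φ (y T)

/-- The value function of the Mayer problem. -/
def valueFn (F : E → Set E) (φ : E → ℝ) (T t : ℝ) (x : E) : ℝ :=
  sInf {r | ∃ y y' : ℝ → E, IsTraj F t T y y' ∧ y t = x ∧ r = φ (y T)}

/-- Fréchet superdifferential of `W` in the pair `(t,x)`. -/
def FSuperPair (W : ℝ → E → ℝ) (t : ℝ) (x : E) : Set (ℝ × E) :=
  {q | ∀ ε > (0:ℝ), ∀ᶠ sy : ℝ × E in 𝓝 (t, x),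
    W sy.1 sy.2 - W t x - q.1 * (sy.1 - t) - ⟪q.2, sy.2 - x⟫ ≤
      ε * ‖((sy.1 - t, sy.2 - x) : ℝ × E)‖}

/-- Fréchet subdifferential of `W` in the pair `(t,x)`. -/
def FSubPair (W : ℝ → E → ℝ) (t : ℝ) (x : E) : Set (ℝ × E) :=
  {q | ∀ ε > (0:ℝ), ∀ᶠ sy : ℝ × E in 𝓝 (t, x),
    -(ε * ‖((sy.1 - t, sy.2 - x) : ℝ × E)‖) ≤
      W sy.1 sy.2 - W t x - q.1 * (sy.1 - t) - ⟪q.2, sy.2 - x⟫}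

/-- Proximal superdifferential of `W` in the pair `(t,x)`. -/
def ProxSuperPair (W : ℝ → E → ℝ) (t : ℝ) (x : E) : Set (ℝ × E) :=
  {q | ∃ c : ℝ, 0 ≤ c ∧ ∃ ρ > (0:ℝ), ∀ s : ℝ, ∀ y : E,
    dist ((s, y) : ℝ × E) ((t, x) : ℝ × E) ≤ ρ →
      W s y - W t x - q.1 * (s - t) - ⟪q.2, y - x⟫ ≤ c * ‖((s - t, y - x) : ℝ × E)‖ ^ 2}

/-- `V` is differentiable at `(t,x)` with (pair) gradient `q = (∂ₜV, ∇ₓV)`. -/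
def HasGradPair (W : ℝ → E → ℝ) (t : ℝ) (x : E) (q : ℝ × E) : Prop :=
  HasFDerivAt (fun sy : ℝ × E => W sy.1 sy.2)
    (q.1 • ContinuousLinearMap.fst ℝ ℝ E +
      (innerSL ℝ q.2).comp (ContinuousLinearMap.snd ℝ ℝ E)) (t, x)

/-- The reachable (limiting) gradient `∂*W(t,x)`. -/
def ReachGradPair (W : ℝ → E → ℝ) (t : ℝ) (x : E) : Set (ℝ × E) :=
  {q | ∃ u g : ℕ → ℝ × E,
    (∀ i, HasGradPair W (u i).1 (u i).2 (g i)) ∧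
    Tendsto u atTop (𝓝 (t, x)) ∧ Tendsto g atTop (𝓝 q)}

/-- Normal cone (of convex analysis) to `A` at `z`. -/
def normalConeAt (A : Set E) (z : E) : Set E :=
  {p | ∀ v ∈ A, ⟪p, v - z⟫ ≤ 0}

/-- `A` is `R`-convex. -/
def RConvex (A : Set E) (R : ℝ) : Prop :=
  ∀ z ∈ frontier A, ∀ y ∈ frontier A, ∀ n ∈ normalConeAt A z, ∀ m ∈ normalConeAt A y,
    ‖n‖ = 1 → ‖m‖ = 1 → ‖z - y‖ ≤ R * ‖n - m‖

/-- `F` is locally strongly convex. -/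
def LocStronglyConvex (F : E → Set E) : Prop :=
  ∀ K : Set E, IsCompact K → ∃ R > (0:ℝ), ∀ x ∈ K, RConvex (F x) R

/-- `ℝⁿ` as a Euclidean space. -/
abbrev Euc (n : ℕ) : Type := EuclideanSpace ℝ (Fin n)


set_option linter.unusedSectionVars false

namespace MayerProblem

section Hamiltonian

variable {F : E → Set E} {x v q : E}

theorem inner_le_ham (hc : IsCompact (F x)) (hv : v ∈ F x) : ⟪v, q⟫ ≤ Ham F x q :=
  le_csSup (hc.image (by fun_prop)).bddAbove (mem_image_of_mem _ hv)

theorem exists_inner_eq_ham (hne : (F x).Nonempty) (hc : IsCompact (F x)) (q : E) :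
    ∃ v ∈ F x, ⟪v, q⟫ = Ham F x q := by
  have := (hc.image (f := fun v => ⟪v, q⟫) (by fun_prop)).sSup_mem (hne.image _)
  exact this

theorem ham_le_of_forall_inner_le (hne : (F x).Nonempty) (hc : IsCompact (F x)) {a : ℝ}
    (h : ∀ v ∈ F x, ⟪v, q⟫ ≤ a) : Ham F x q ≤ a := by
  obtain ⟨v, hv, e⟩ := exists_inner_eq_ham hne hc q
  exact e ▸ h v hv

/-- A vector whose support inequalities hold up to an error `δ` is `δ`-close to `F x`. -/
theorem exists_mem_norm_sub_le (hne : (F x).Nonempty) (hcv : Convex ℝ (F x))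
    (hc : IsCompact (F x)) {δ : ℝ} (hδ : 0 ≤ δ) (h : ∀ q, ⟪v, q⟫ ≤ Ham F x q + δ * ‖q‖) :
    ∃ u ∈ F x, ‖v - u‖ ≤ δ := by
  obtain ⟨u, hu, hmin⟩ := exists_norm_eq_iInf_of_complete_convex hne hc.isComplete hcv v
  rw [norm_eq_iInf_iff_real_inner_le_zero hcv hu] at hmin
  refine ⟨u, hu, ?_⟩
  have h1 : Ham F x (v - u) ≤ ⟪u, v - u⟫ := by
    refine ham_le_of_forall_inner_le hne hc fun w hw => ?_
    have := hmin w hw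
    rw [inner_sub_right, real_inner_comm w, real_inner_comm u] at this
    linarith
  have h2 := h (v - u)
  have h3 : ‖v - u‖ * ‖v - u‖ ≤ δ * ‖v - u‖ := by
    rw [← real_inner_self_eq_norm_mul_norm, inner_sub_left]; linarith
  by_contra hlt
  push Not at hlt
  nlinarith [norm_nonneg (v - u)]

theorem mem_of_forall_inner_le_ham (hne : (F x).Nonempty) (hcv : Convex ℝ (F x))
    (hc : IsCompact (F x)) (h : ∀ q, ⟪v, q⟫ ≤ Ham F x q) : v ∈ F x := by
  obtain ⟨u, hu, hle⟩ := exists_mem_norm_sub_le (δ := 0) hne hcv hc le_rfl (by simpa using h)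
  rw [norm_le_zero_iff, sub_eq_zero] at hle
  exact hle ▸ hu

theorem ham_sub_le (hne : (F x).Nonempty) (hc : IsCompact (F x)) {M : ℝ}
    (hM : ∀ v ∈ F x, ‖v‖ ≤ M) (q q' : E) : Ham F x q - Ham F x q' ≤ M * ‖q - q'‖ := by
  obtain ⟨v, hv, e⟩ := exists_inner_eq_ham hne hc q
  have h1 := inner_le_ham (q := q') hc hv
  have h2 : ⟪v, q - q'⟫ ≤ M * ‖q - q'‖ :=
    (real_inner_le_norm _ _).trans (mul_le_mul_of_nonneg_right (hM v hv) (norm_nonneg _))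
  rw [inner_sub_right] at h2
  linarith

/-- At a point of differentiability of `H(x,·)`, every maximizer is the gradient. -/
theorem eq_of_hasGradientAt_ham (hc : IsCompact (F x)) {g p : E}
    (hg : HasGradientAt (fun q => Ham F x q) g p) (hv : v ∈ F x) (he : ⟪v, p⟫ = Ham F x p) :
    v = g := by
  have h1 : HasFDerivAt (fun q => Ham F x q - ⟪v, q⟫)
      ((InnerProductSpace.toDual ℝ E) g - innerSL ℝ v) p :=
    (hasGradientAt_iff_hasFDerivAt.1 hg).sub (innerSL ℝ v).hasFDerivAt
  have hmin : IsLocalMin (fun q => Ham F x q - ⟪v, q⟫) p := by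
    refine Eventually.of_forall fun q => ?_
    have := inner_le_ham (q := q) hc hv
    simp only [he]
    linarith
  have h0 := hmin.hasFDerivAt_eq_zero h1
  refine ext_inner_right ℝ fun u => ?_
  have := congrArg (fun f => f u) h0
  simp at this
  linarith

theorem gradpH_mem (hne : (F x).Nonempty) (hc : IsCompact (F x)) {p : E}
    (hg : HasGradientAt (fun q => Ham F x q) (gradpH F x p) p) :
    gradpH F x p ∈ F x ∧ ⟪gradpH F x p, p⟫ = Ham F x p := by
  obtain ⟨v, hv, e⟩ := exists_inner_eq_ham hne hc p
  rw [← eq_of_hasGradientAt_ham hc hg hv e]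
  exact ⟨hv, e⟩

theorem ham_smul (a : ℝ) (ha : 0 ≤ a) (q : E) : Ham F x (a • q) = a * Ham F x q := by
  rw [Ham, Ham, ← smul_eq_mul, ← Real.sSup_smul_of_nonneg ha, ← image_smul, image_image]
  simp [inner_smul_right]

end Hamiltonian

section Semiconvex

/-- A continuous midpoint-convex function on a convex set is convex. -/
theorem convexOn_of_continuousOn_of_midpoint {f : E → ℝ} {s : Set E} (hs : Convex ℝ s)
    (hf : ContinuousOn f s)
    (hmid : ∀ x h : E, x + h ∈ s → x - h ∈ s → 2 * f x ≤ f (x + h) + f (x - h)) :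
    ConvexOn ℝ s f := by
  refine ⟨hs, fun a ha b hb α β hα hβ hαβ => ?_⟩
  set γ : ℝ → E := fun t => a + t • (b - a) with hγ
  have hγs : ∀ t ∈ Icc (0:ℝ) 1, γ t ∈ s := fun t ht =>
    hs.add_smul_sub_mem ha hb ht
  set g : ℝ → ℝ := fun t => f (γ t) - (f a + t * (f b - f a)) with hg
  have hgc : ContinuousOn g (Icc 0 1) := by
    refine ContinuousOn.sub (hf.comp (by fun_prop) hγs) (by fun_prop)
  obtain ⟨t, ht, htmax⟩ := isCompact_Icc.exists_isMaxOn (nonempty_Icc.2 zero_le_one) hgc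
  have g0 : g 0 = 0 := by simp [hg, hγ]
  have g1 : g 1 = 0 := by simp [hg, hγ]
  have hmid' : ∀ d, t - d ∈ Icc (0:ℝ) 1 → t + d ∈ Icc (0:ℝ) 1 →
      2 * g t ≤ g (t + d) + g (t - d) := by
    intro d h1 h2
    have e1 : γ (t + d) = γ t + d • (b - a) := by simp only [hγ]; module
    have e2 : γ (t - d) = γ t - d • (b - a) := by simp only [hγ]; module
    have := hmid (γ t) (d • (b - a)) (e1 ▸ hγs _ h2) (e2 ▸ hγs _ h1)
    simp only [hg, e1, e2]
    linarith
  have hle : g t ≤ 0 := by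
    rcases le_total t (1 / 2) with h | h
    · have h2 : t + t ∈ Icc (0:ℝ) 1 := ⟨by linarith [ht.1], by linarith⟩
      have := hmid' t (by simp) h2
      have h3 : g (t + t) ≤ g t := htmax h2
      simp only [sub_self, g0] at this
      linarith
    · have h2 : t - (1 - t) ∈ Icc (0:ℝ) 1 := ⟨by linarith, by linarith [ht.2]⟩
      have := hmid' (1 - t) h2 (by simp)
      have h3 : g (t - (1 - t)) ≤ g t := htmax h2
      simp only [add_sub_cancel, g1] at this
      linarith
  have hβ1 : β ∈ Icc (0:ℝ) 1 := ⟨hβ, by linarith⟩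
  have h4 : g β ≤ g t := htmax hβ1
  have e3 : α • a + β • b = γ β := by
    simp only [hγ]
    rw [eq_sub_iff_add_eq.2 hαβ]
    module
  rw [e3, smul_eq_mul, smul_eq_mul, eq_sub_iff_add_eq.2 hαβ]
  simp only [hg] at h4 hle
  linarith

/-- A convex continuous function on an open convex set has a subgradient at every point. -/
theorem exists_subgradient {f : E → ℝ} {s : Set E} (hs : IsOpen s) (hf : ConvexOn ℝ s f)
    (hfc : ContinuousOn f s) {z : E} (hz : z ∈ s) :
    ∃ ζ : E, ∀ w ∈ s, f z + ⟪ζ, w - z⟫ ≤ f w := by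
  have hopen : IsOpen {p : E × ℝ | p.1 ∈ s ∧ f p.1 < p.2} := by
    have h1 : ContinuousOn (fun p : E × ℝ => p.2 - f p.1) (Prod.fst ⁻¹' s) :=
      continuousOn_snd.sub (hfc.comp continuousOn_fst fun p hp => hp)
    have := h1.isOpen_inter_preimage (hs.preimage continuous_fst) (isOpen_Ioi (a := (0:ℝ)))
    convert this using 1
    ext p
    simp
  obtain ⟨ℓ, hℓ⟩ := geometric_hahn_banach_open_point hf.convex_strict_epigraph hopen
    (x := (z, f z)) (by simp)
  have hsplit : ∀ w : E, ∀ a : ℝ, ℓ (w, a) = ℓ (w, 0) + a * ℓ (0, 1) := by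
    intro w a
    rw [← smul_eq_mul, ← map_smul, ← map_add]
    simp
  have hβ : ℓ (0, 1) < 0 := by
    have := hℓ (z, f z + 1) ⟨hz, by simp⟩
    rw [hsplit z (f z + 1), hsplit z (f z)] at this
    linarith
  set β := ℓ (0, 1)
  set ζ := (InnerProductSpace.toDual ℝ E).symm
    ((-β)⁻¹ • ℓ.comp (ContinuousLinearMap.inl ℝ E ℝ)) with hζ
  refine ⟨ζ, fun w hw => ?_⟩
  have e : ⟪ζ, w - z⟫ = (-β)⁻¹ * (ℓ (w, 0) - ℓ (z, 0)) := by
    rw [hζ, InnerProductSpace.toDual_symm_apply, ← map_sub]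
    simp
  rw [e]
  refine le_of_forall_pos_lt_add fun ε hε => ?_
  have := hℓ (w, f w + ε) ⟨hw, by simp [hε]⟩
  rw [hsplit w, hsplit z (f z)] at this
  have h5 : (-β)⁻¹ * (ℓ (w, 0) - ℓ (z, 0)) < (-β)⁻¹ * ((-β) * (f w + ε - f z)) :=
    mul_lt_mul_of_pos_left (by linarith) (inv_pos.2 (by linarith))
  rw [inv_mul_cancel_left₀ (by linarith)] at h5
  linarith

end Semiconvex

section LocalBounds

variable {F : E → Set E}

/-- Quantitative consequences of (SH) and (H1) on the ball of radius `R`: `M` bounds the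
velocities, `L` is a Lipschitz constant and `c` a semiconvexity constant. -/
structure LocalBounds (F : E → Set E) (R L c M : ℝ) : Prop where
  L_nonneg : 0 ≤ L
  c_nonneg : 0 ≤ c
  M_nonneg : 0 ≤ M
  norm_le : ∀ {x}, ‖x‖ ≤ R → ∀ v ∈ F x, ‖v‖ ≤ M
  ham_lip : ∀ {x x'}, ‖x‖ ≤ R → ‖x'‖ ≤ R → ∀ q,
    Ham F x q ≤ Ham F x' q + L * ‖x - x'‖ * ‖q‖
  exists_selection : ∀ {x x'}, ‖x‖ ≤ R → ‖x'‖ ≤ R → ∀ q, ∀ v ∈ F x, ⟪v, q⟫ = Ham F x q →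
    ∃ v' ∈ F x', ⟪v', q⟫ = Ham F x' q ∧ ‖v' - v‖ ≤ L * ‖x' - x‖
  exists_subgradient : ∀ {z}, ‖z‖ < R → ∀ q, ∃ ζ, ∀ w, ‖w‖ < R →
    Ham F z q + ⟪ζ, w - z⟫ - c * ‖q‖ * ‖w - z‖ ^ 2 ≤ Ham F w q

theorem gradpH_lipschitz [FiniteDimensional ℝ E] (hSH : StandingHyp F) (hH1 : HypH1 F) {R : ℝ}
    (hR : 0 < R) : ∃ L : ℝ, 0 ≤ L ∧ ∀ q ≠ 0, ∀ x x', ‖x‖ ≤ R → ‖x'‖ ≤ R →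
      ‖gradpH F x q - gradpH F x' q‖ ≤ L * ‖x - x'‖ := by
  obtain ⟨L, hL⟩ := hH1.2.2 (closedBall 0 R) ⟨0, by simp [hR.le]⟩ (convex_closedBall _ _)
    (isCompact_closedBall _ _) (sphere 0 1) (isCompact_sphere _ _) (by simp)
  refine ⟨L, L.2, fun q hq x x' hx hx' => ?_⟩
  have hs : ∀ x, gradpH F x q = gradpH F x (‖q‖⁻¹ • q) := fun x => by
    have hc := (hSH.1 x).2.2
    have hne := (hSH.1 x).1
    have hq' : ‖q‖⁻¹ • q ≠ 0 := smul_ne_zero (by simpa using hq) hq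
    obtain ⟨h1, h2⟩ := gradpH_mem hne hc (hH1.2.1 x q hq)
    refine eq_of_hasGradientAt_ham hc (hH1.2.1 x _ hq') h1 ?_
    rw [ham_smul _ (by positivity), inner_smul_right, h2]
  rw [hs x, hs x']
  have := (hL (‖q‖⁻¹ • q) (by simp [norm_smul, hq])).norm_sub_le
    (x := x) (by simpa using hx) (y := x') (by simpa using hx')
  exact this

theorem exists_localBounds [FiniteDimensional ℝ E] (hSH : StandingHyp F) (hH1 : HypH1 F) {R : ℝ}
    (hR : 0 < R) : ∃ L c M : ℝ, LocalBounds F R L c M := by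
  obtain ⟨L, hL0, hL⟩ := gradpH_lipschitz hSH hH1 hR
  obtain ⟨c, hc0, hc⟩ := hH1.1 (closedBall 0 R) ⟨0, by simp [hR.le]⟩ (convex_closedBall _ _)
    (isCompact_closedBall _ _)
  obtain ⟨r, hr0, hr⟩ := hSH.2.2
  have hmem : ∀ x q, q ≠ 0 → gradpH F x q ∈ F x ∧ ⟪gradpH F x q, q⟫ = Ham F x q :=
    fun x q hq => gradpH_mem (hSH.1 x).1 (hSH.1 x).2.2 (hH1.2.1 x q hq)
  have hzero : ∀ x, Ham F x 0 = 0 := fun x => by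
    simpa using ham_smul (F := F) (x := x) 0 le_rfl 0
  have hlip : ∀ {x x'}, ‖x‖ ≤ R → ‖x'‖ ≤ R → ∀ q,
      Ham F x q ≤ Ham F x' q + L * ‖x - x'‖ * ‖q‖ := by
    intro x x' hx hx' q
    by_cases hq : q = 0
    · simp [hq, hzero]
    · rw [← (hmem x q hq).2, ← (hmem x' q hq).2, ← sub_le_iff_le_add', ← inner_sub_left]
      exact (real_inner_le_norm _ _).trans
        (mul_le_mul_of_nonneg_right (hL q hq x x' hx hx') (norm_nonneg _))
  refine ⟨L, c / 2, r * (1 + R), hL0, by positivity, by positivity, ?_, hlip, ?_, ?_⟩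
  · intro x hx v hv
    exact (hr x v hv).trans (by gcongr)
  · intro x x' hx hx' q v hv he
    by_cases hq : q = 0
    · obtain ⟨u, hu, hle⟩ := exists_mem_norm_sub_le (F := F) (x := x') (v := v) (hSH.1 x').1
        (hSH.1 x').2.1 (hSH.1 x').2.2 (δ := L * ‖x - x'‖) (by positivity)
        (fun q => (inner_le_ham (hSH.1 x).2.2 hv).trans (hlip hx hx' q))
      exact ⟨u, hu, by simp [hq, hzero], by rwa [norm_sub_rev, norm_sub_rev x']⟩
    · refine ⟨gradpH F x' q, (hmem x' q hq).1, (hmem x' q hq).2, ?_⟩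
      rw [eq_of_hasGradientAt_ham (hSH.1 x).2.2 (hH1.2.1 x q hq) hv he]
      exact hL q hq x' x hx' hx
  · intro z hz q
    set k := c * ‖q‖ with hk
    have hcont : ContinuousOn (fun x => Ham F x q) (ball 0 R) := by
      refine (LipschitzOnWith.of_dist_le_mul (K := (L * ‖q‖).toNNReal) ?_).continuousOn
      intro x hx y hy
      rw [mem_ball_zero_iff] at hx hy
      have h1 := hlip hx.le hy.le q
      have h2 := hlip hy.le hx.le q
      rw [norm_sub_rev] at h2
      rw [Real.dist_eq, dist_eq_norm, abs_le]
      rw [Real.coe_toNNReal _ (by positivity)]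
      constructor <;> nlinarith
    have hcont' : ContinuousOn (fun x => Ham F x q + k / 2 * ‖x‖ ^ 2) (ball 0 R) :=
      hcont.add (by fun_prop)
    have hconv : ConvexOn ℝ (ball 0 R) (fun x => Ham F x q + k / 2 * ‖x‖ ^ 2) := by
      refine convexOn_of_continuousOn_of_midpoint (convex_ball _ _) hcont' fun x h h1 h2 => ?_
      have h3 := hc q x h (ball_subset_closedBall h1) (ball_subset_closedBall h2)
      have h4 := parallelogram_law_with_norm ℝ x h
      have h5 := congrArg (fun a => k / 2 * a) h4
      simp only [← hk] at h3 h5 ⊢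
      linarith
    obtain ⟨η, hη⟩ := MayerProblem.exists_subgradient isOpen_ball hconv hcont' (z := z)
      (by simpa using hz)
    refine ⟨η - k • z, fun w hw => ?_⟩
    have h1 := hη w (by simpa using hw)
    have h2 : ‖w‖ ^ 2 = ‖z‖ ^ 2 + 2 * ⟪z, w - z⟫ + ‖w - z‖ ^ 2 := by
      rw [← norm_add_sq_real]; simp
    rw [inner_sub_left, real_inner_smul_left]
    simp only [h2] at h1
    have e : c / 2 * ‖q‖ = k / 2 := by rw [hk]; ring
    rw [e]
    linarith

theorem LocalBounds.norm_subgradient_le {R L c M : ℝ} (h : LocalBounds F R L c M) {z q ζ : E}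
    (hz : ‖z‖ + 1 < R)
    (hζ : ∀ w, ‖w‖ < R → Ham F z q + ⟪ζ, w - z⟫ - c * ‖q‖ * ‖w - z‖ ^ 2 ≤ Ham F w q) :
    ‖ζ‖ ≤ (L + c) * ‖q‖ := by
  have hL := h.L_nonneg
  have hc := h.c_nonneg
  rcases eq_or_ne ζ 0 with rfl | h0
  · simp; positivity
  set u := ‖ζ‖⁻¹ • ζ
  have hu : ‖u‖ = 1 := by simp [u, norm_smul, h0]
  have hw : ‖z + u‖ < R := (norm_add_le _ _).trans_lt (by rwa [hu])
  have h1 := hζ (z + u) hw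
  have h2 := h.ham_lip hw.le (by linarith) q (x' := z)
  have h3 : ⟪ζ, u⟫ = ‖ζ‖ := by
    simp only [u, inner_smul_right, real_inner_self_eq_norm_sq]
    field_simp
  simp only [add_sub_cancel_left, hu, h3] at h1 h2
  nlinarith

/-- A quadratic lower bound on a ball around `z` gives a Fréchet subgradient. -/
theorem mem_fsub_of_quadratic {f : E → ℝ} {z ζ : E} {k R : ℝ} (hz : ‖z‖ < R)
    (h : ∀ w, ‖w‖ < R → f z + ⟪ζ, w - z⟫ - k * ‖w - z‖ ^ 2 ≤ f w) : ζ ∈ FSub f z := by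
  intro ε hε
  have h1 : ∀ᶠ w in 𝓝 z, ‖w‖ < R := continuous_norm.continuousAt.eventually (gt_mem_nhds hz)
  have h2 : ∀ᶠ w in 𝓝 z, k * ‖w - z‖ < ε := by
    have : Tendsto (fun w => k * ‖w - z‖) (𝓝 z) (𝓝 (k * ‖z - z‖)) :=
      Continuous.tendsto (by fun_prop) z
    exact this.eventually (gt_mem_nhds (by simpa using hε))
  filter_upwards [h1, h2] with w hw1 hw2
  have := h w hw1
  nlinarith [norm_nonneg (w - z)]

end LocalBounds

section Arcs

variable {F : E → Set E} {t T : ℝ} {y y' : ℝ → E}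

theorem lipschitzOnWith_of_norm_sub_le {K : ℝ} (hK : 0 ≤ K)
    (hy : ∀ a b, t ≤ a → a ≤ b → b ≤ T → ‖y b - y a‖ ≤ K * (b - a)) :
    LipschitzOnWith K.toNNReal y (Icc t T) := by
  refine LipschitzOnWith.of_dist_le_mul fun a ha b hb => ?_
  rw [Real.coe_toNNReal _ hK]
  rcases le_total a b with h | h
  · rw [dist_comm, dist_comm a, dist_eq_norm, Real.dist_eq, abs_of_nonneg (by linarith)]
    exact hy a b ha.1 h hb.2
  · rw [dist_eq_norm, Real.dist_eq, abs_of_nonneg (by linarith)]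
    exact hy b a hb.1 h ha.2

/-- A Lipschitz curve is the integral of its derivative. -/
theorem acArc_deriv_of_lipschitz [FiniteDimensional ℝ E] (htT : t ≤ T) {K : ℝ} (hK : 0 ≤ K)
    (hy : ∀ a b, t ≤ a → a ≤ b → b ≤ T → ‖y b - y a‖ ≤ K * (b - a)) :
    ACArc t T y (deriv y) := by
  have hlip := lipschitzOnWith_of_norm_sub_le hK hy
  have hae : ∀ᵐ s ∂(volume : Measure ℝ), s ∈ Icc t T → HasDerivAt y (deriv y s) s := by
    have h1 := hlip.ae_differentiableWithinAt_real measurableSet_Icc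
    rw [ae_restrict_iff' measurableSet_Icc] at h1
    have h2 : ∀ᵐ s ∂(volume : Measure ℝ), s ≠ t := by simp [ae_iff]
    have h3 : ∀ᵐ s ∂(volume : Measure ℝ), s ≠ T := by simp [ae_iff]
    filter_upwards [h1, h2, h3] with s hs hst hsT hmem
    exact ((hs hmem).differentiableAt
      (Icc_mem_nhds (lt_of_le_of_ne hmem.1 hst.symm) (lt_of_le_of_ne hmem.2 hsT))).hasDerivAt
  have hbound : ∀ᵐ s ∂(volume : Measure ℝ), s ∈ Icc t T → ‖deriv y s‖ ≤ K := by
    have h2 : ∀ᵐ s ∂(volume : Measure ℝ), s ≠ t := by simp [ae_iff]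
    have h3 : ∀ᵐ s ∂(volume : Measure ℝ), s ≠ T := by simp [ae_iff]
    filter_upwards [h2, h3] with s hst hsT hmem
    have := norm_deriv_le_of_lipschitzOn
      (Icc_mem_nhds (lt_of_le_of_ne hmem.1 hst.symm) (lt_of_le_of_ne hmem.2 hsT)) hlip
    rwa [Real.coe_toNNReal _ hK] at this
  have hyi : IntervalIntegrable (deriv y) volume t T := by
    rw [intervalIntegrable_iff_integrableOn_Icc_of_le htT]
    refine Measure.integrableOn_of_bounded (M := K) (by simp)
      (stronglyMeasurable_deriv y).aestronglyMeasurable ?_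
    rwa [ae_restrict_iff' measurableSet_Icc]
  refine ⟨hyi, fun s hs => ?_, hae⟩
  have hsub : uIcc t s ⊆ uIcc t T := by
    rw [uIcc_of_le hs.1, uIcc_of_le htT]; exact Icc_subset_Icc_right hs.2
  have hyi' := hyi.mono_set hsub
  rw [← sub_eq_iff_eq_add']
  refine ext_inner_left ℝ fun q => ?_
  have hq : AbsolutelyContinuousOnInterval (fun s => ⟪q, y s⟫) t s := by
    refine LipschitzOnWith.absolutelyContinuousOnInterval (K := ‖innerSL ℝ q‖₊ * K.toNNReal) ?_
    refine (innerSL ℝ q).lipschitz.comp_lipschitzOnWith (hlip.mono ?_)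
    rwa [uIcc_of_le htT] at hsub
  have h2 := hq.integral_deriv_eq_sub
  have h3 : ∫ r in t..s, deriv (fun s => ⟪q, y s⟫) r = ∫ r in t..s, innerSL ℝ q (deriv y r) := by
    refine intervalIntegral.integral_congr_ae ?_
    filter_upwards [hae] with r hr hmem
    rw [uIoc_of_le hs.1] at hmem
    exact ((innerSL ℝ q).hasFDerivAt.comp_hasDerivAt r
      (hr ⟨hmem.1.le, hmem.2.trans hs.2⟩)).deriv
  rw [h3, (innerSL ℝ q).intervalIntegral_comp_comm hyi'] at h2
  rw [inner_sub_right, ← h2]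
  rfl

theorem acArc_sub_eq (h : ACArc t T y y') {a b : ℝ} (ha : t ≤ a) (hab : a ≤ b) (hb : b ≤ T) :
    IntervalIntegrable y' volume a b ∧ y b - y a = ∫ r in a..b, y' r := by
  have hsub : ∀ {a b}, t ≤ a → a ≤ b → b ≤ T → IntervalIntegrable y' volume a b := by
    intro a b ha hab hb
    refine h.1.mono_set ?_
    rw [uIcc_of_le hab, uIcc_of_le (ha.trans (hab.trans hb))]
    exact Icc_subset_Icc ha hb
  refine ⟨hsub ha hab hb, ?_⟩
  rw [h.2.1 b ⟨ha.trans hab, hb⟩, h.2.1 a ⟨ha, hab.trans hb⟩, add_sub_add_left_eq_sub,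
    intervalIntegral.integral_interval_sub_left]
  · exact hsub le_rfl (ha.trans hab) hb
  · exact hsub le_rfl ha (hab.trans hb)

theorem acArc_continuousOn (h : ACArc t T y y') (htT : t ≤ T) : ContinuousOn y (Icc t T) := by
  have := intervalIntegral.continuousOn_primitive_interval' h.1 (left_mem_uIcc (a := t) (b := T))
  rw [uIcc_of_le htT] at this
  exact (this.const_add (y t)).congr fun s hs => h.2.1 s hs

theorem isTraj_mono {t' : ℝ} (h : IsTraj F t T y y') (ht : t ≤ t') (htT : t' ≤ T) :
    IsTraj F t' T y y' := by
  refine ⟨⟨(acArc_sub_eq h.1 ht htT le_rfl).1, fun s hs => ?_, ?_⟩, ?_⟩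
  · rw [← sub_eq_iff_eq_add']
    exact (acArc_sub_eq h.1 ht hs.1 hs.2).2
  · filter_upwards [h.1.2.2] with s h1 hs using h1 ⟨ht.trans hs.1, hs.2⟩
  · filter_upwards [h.2] with s h1 hs using h1 ⟨ht.trans hs.1, hs.2⟩

/-- A priori bound on trajectories coming from sublinear growth. -/
theorem isTraj_norm_le (h : IsTraj F t T y y') (htT : t ≤ T) {r : ℝ} (hr : 0 < r)
    (hF : ∀ x : E, ∀ v ∈ F x, ‖v‖ ≤ r * (1 + ‖x‖)) {s : ℝ} (hs : s ∈ Icc t T) :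
    1 + ‖y s‖ ≤ (1 + ‖y t‖) * Real.exp (r * (s - t)) := by
  set u : ℝ → ℝ := fun s => 1 + ‖y (projIcc t T htT s)‖ with hu
  have huc : Continuous u := by
    have := (continuousOn_iff_continuous_domRestrict.1 (acArc_continuousOn h.1 htT)).comp
      (continuous_projIcc (h := htT))
    exact continuous_const.add this.norm
  have hueq : ∀ s ∈ Icc t T, u s = 1 + ‖y s‖ := fun s hs => by simp [hu, projIcc_of_mem htT hs]
  set U : ℝ → ℝ := fun s => (1 + ‖y t‖) + ∫ x in t..s, r * u x with hU
  have hUd : ∀ s, HasDerivAt U (r * u s) s := fun s =>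
    ((continuous_const.mul huc).integral_hasStrictDerivAt t s).hasDerivAt.const_add _
  have hle : ∀ s ∈ Icc t T, u s ≤ U s := by
    intro s hs
    rw [hueq s hs, hU, h.1.2.1 s hs]
    have : ‖∫ x in t..s, y' x‖ ≤ ∫ x in t..s, r * u x := by
      refine intervalIntegral.norm_integral_le_of_norm_le hs.1 ?_
        ((continuous_const.mul huc).intervalIntegrable _ _)
      filter_upwards [h.2] with x hx hmem
      have hx' : x ∈ Icc t T := ⟨hmem.1.le, hmem.2.trans hs.2⟩
      rw [hueq x hx']
      exact hF _ _ (hx hx')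
    have h2 := norm_add_le (y t) (∫ x in t..s, y' x)
    simp only
    linarith
  have hupos : ∀ s, 0 ≤ u s := fun s => by positivity
  have hG := norm_le_gronwallBound_of_norm_deriv_right_le (f := U) (f' := fun s => r * u s)
    (δ := 1 + ‖y t‖) (K := r) (ε := 0) (a := t) (b := T)
    (fun s _ => (hUd s).continuousAt.continuousWithinAt)
    (fun s _ => (hUd s).hasDerivWithinAt)
    (by simp only [hU, intervalIntegral.integral_same, add_zero]
        rw [Real.norm_of_nonneg (by positivity)])
    (fun s hs => by
      have h1 := hle s ⟨hs.1, hs.2.le⟩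
      rw [Real.norm_of_nonneg (mul_nonneg hr.le (hupos s)),
        Real.norm_of_nonneg ((hupos s).trans h1), add_zero]
      gcongr) s hs
  rw [gronwallBound_ε0] at hG
  rw [← hueq s hs]
  exact (hle s hs).trans ((Real.le_norm_self _).trans hG)

/-- The integrated form of the differential inclusion `y' ∈ F y`, which is stable under pointwise
limits. -/
def IntTraj (F : E → Set E) (t T C : ℝ) (y : ℝ → E) : Prop :=
  ∀ a b, t ≤ a → a ≤ b → b ≤ T → ∀ q,
    ⟪y b - y a, q⟫ ≤ (b - a) * (Ham F (y a) q + C * (b - a) * ‖q‖)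

theorem isTraj_norm_sub_le {R L c M : ℝ} (hB : LocalBounds F R L c M) (h : IsTraj F t T y y')
    (hR : ∀ s ∈ Icc t T, ‖y s‖ ≤ R) {a b : ℝ} (ha : t ≤ a) (hab : a ≤ b) (hb : b ≤ T) :
    ‖y b - y a‖ ≤ M * (b - a) := by
  rw [(acArc_sub_eq h.1 ha hab hb).2, ← abs_of_nonneg (sub_nonneg.2 hab)]
  refine intervalIntegral.norm_integral_le_of_norm_le_const_ae ?_
  filter_upwards [h.2] with x hx hmem
  rw [uIoc_of_le hab] at hmem
  have hx' : x ∈ Icc t T := ⟨ha.trans hmem.1.le, hmem.2.trans hb⟩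
  exact hB.norm_le (hR x hx') _ (hx hx')

theorem isTraj_intTraj (hF : ∀ x, (F x).Nonempty ∧ Convex ℝ (F x) ∧ IsCompact (F x))
    {R L c M : ℝ} (hB : LocalBounds F R L c M) (h : IsTraj F t T y y')
    (hR : ∀ s ∈ Icc t T, ‖y s‖ ≤ R) : IntTraj F t T (L * M) y := by
  intro a b ha hab hb q
  obtain ⟨hyi, heq⟩ := acArc_sub_eq h.1 ha hab hb
  have hL := hB.L_nonneg
  have hM := hB.M_nonneg
  have h1 : ∫ x in a..b, innerSL ℝ q (y' x) ≤
      ∫ _ in a..b, (Ham F (y a) q + L * M * (b - a) * ‖q‖) := by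
    refine intervalIntegral.integral_mono_ae_restrict hab ?_ (by simp) ?_
    · exact ⟨(innerSL ℝ q).integrable_comp hyi.1, (innerSL ℝ q).integrable_comp hyi.2⟩
    rw [EventuallyLE, ae_restrict_iff' measurableSet_Icc]
    filter_upwards [h.2] with x hx hmem
    have hx' : x ∈ Icc t T := ⟨ha.trans hmem.1, hmem.2.trans hb⟩
    have h2 := inner_le_ham (q := q) (hF (y x)).2.2 (hx hx')
    have h3 := hB.ham_lip (hR x hx') (hR a ⟨ha, hab.trans hb⟩) q
    have h4 := isTraj_norm_sub_le hB h hR ha hmem.1 hx'.2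
    have h5 : L * ‖y x - y a‖ * ‖q‖ ≤ L * (M * (b - a)) * ‖q‖ := by
      gcongr
      exact h4.trans (mul_le_mul_of_nonneg_left (by linarith [hmem.2]) hM)
    rw [innerSL_apply_apply, real_inner_comm]
    linarith
  rw [(innerSL ℝ q).intervalIntegral_comp_comm hyi, intervalIntegral.integral_const,
    smul_eq_mul, innerSL_apply_apply, real_inner_comm, ← heq] at h1
  exact h1

/-- A one-sided quadratic growth estimate bounds the derivative. -/
theorem deriv_le_of_quadratic {g : ℝ → ℝ} {g' a A B : ℝ} (hg : HasDerivAt g g' a) (haT : a < T)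
    (h : ∀ b, a < b → b ≤ T → g b - g a ≤ (b - a) * (A + B * (b - a))) : g' ≤ A := by
  have h1 : Tendsto (slope g a) (𝓝[>] a) (𝓝 g') :=
    (hasDerivAt_iff_tendsto_slope.1 hg).mono_left
      (nhdsWithin_mono _ fun x hx => ne_of_gt hx)
  have h2 : Tendsto (fun b => A + B * (b - a)) (𝓝[>] a) (𝓝 A) := by
    have : Tendsto (fun b => A + B * (b - a)) (𝓝 a) (𝓝 (A + B * (a - a))) :=
      Continuous.tendsto (by fun_prop) a
    simpa using this.mono_left nhdsWithin_le_nhds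
  refine le_of_tendsto_of_tendsto h1 h2 ?_
  filter_upwards [Ioc_mem_nhdsGT haT] with b hb
  rw [slope_def_field, div_le_iff₀ (by linarith [hb.1])]
  linarith [h b hb.1 hb.2]

theorem IntTraj.mem_of_hasDerivAt
    (hF : ∀ x, (F x).Nonempty ∧ Convex ℝ (F x) ∧ IsCompact (F x)) {C : ℝ}
    (h : IntTraj F t T C y) {a : ℝ} (ha : a ∈ Ico t T) {v : E} (hv : HasDerivAt y v a) :
    v ∈ F (y a) := by
  refine mem_of_forall_inner_le_ham (hF _).1 (hF _).2.1 (hF _).2.2 fun q => ?_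
  have h1 : HasDerivAt (fun s => ⟪q, y s⟫) ⟪q, v⟫ a :=
    (innerSL ℝ q).hasFDerivAt.comp_hasDerivAt a hv
  rw [real_inner_comm]
  refine deriv_le_of_quadratic (B := C * ‖q‖) h1 ha.2 fun b hab hb => ?_
  have := h a b ha.1 hab.le hb q
  rw [← inner_sub_right, real_inner_comm]
  linarith

theorem IntTraj.isTraj [FiniteDimensional ℝ E]
    (hF : ∀ x, (F x).Nonempty ∧ Convex ℝ (F x) ∧ IsCompact (F x)) {C K : ℝ} (htT : t ≤ T)
    (h : IntTraj F t T C y) (hK : 0 ≤ K)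
    (hy : ∀ a b, t ≤ a → a ≤ b → b ≤ T → ‖y b - y a‖ ≤ K * (b - a)) :
    IsTraj F t T y (deriv y) := by
  have hac := acArc_deriv_of_lipschitz htT hK hy
  refine ⟨hac, ?_⟩
  have h3 : ∀ᵐ s ∂(volume : Measure ℝ), s ≠ T := by simp [ae_iff]
  filter_upwards [hac.2.2, h3] with s hs hsT hmem
  exact h.mem_of_hasDerivAt hF ⟨hmem.1, lt_of_le_of_ne hmem.2 hsT⟩ (hs hmem)

/-- Concatenation of two trajectories. -/
theorem exists_isTraj_concat [FiniteDimensional ℝ E]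
    (hF : ∀ x, (F x).Nonempty ∧ Convex ℝ (F x) ∧ IsCompact (F x)) {R L c M : ℝ}
    (hB : LocalBounds F R L c M) {s : ℝ} (hts : t ≤ s) (hsT : s ≤ T) {z z' : ℝ → E}
    (hy : IsTraj F t T y y') (hz : IsTraj F s T z z') (hyz : y s = z s)
    (hyR : ∀ a ∈ Icc t T, ‖y a‖ ≤ R) (hzR : ∀ a ∈ Icc s T, ‖z a‖ ≤ R) :
    ∃ w w' : ℝ → E, IsTraj F t T w w' ∧ w t = y t ∧ w T = z T := by
  have hL := hB.L_nonneg
  have hM := hB.M_nonneg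
  set w : ℝ → E := fun u => if u ≤ s then y u else z u with hw
  have hwy : ∀ u, u ≤ s → w u = y u := fun u hu => if_pos hu
  have hwz : ∀ u, s ≤ u → w u = z u := fun u hu => by
    rcases hu.eq_or_lt with rfl | h
    · rw [hwy _ le_rfl, hyz]
    · exact if_neg (not_le.2 h)
  have hlip : ∀ a b, t ≤ a → a ≤ b → b ≤ T → ‖w b - w a‖ ≤ M * (b - a) := by
    intro a b ha hab hb
    rcases le_total b s with h1 | h1
    · rw [hwy b h1, hwy a (hab.trans h1)]
      exact isTraj_norm_sub_le hB hy hyR ha hab hb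
    rcases le_total s a with h2 | h2
    · rw [hwz b h1, hwz a h2]
      exact isTraj_norm_sub_le hB hz hzR h2 hab hb
    · have e1 := isTraj_norm_sub_le hB hy hyR ha h2 hsT
      have e2 := isTraj_norm_sub_le hB hz hzR le_rfl h1 hb
      rw [hwz b h1, hwy a h2]
      calc ‖z b - y a‖ = ‖(z b - z s) + (y s - y a)‖ := by rw [hyz]; abel_nf
        _ ≤ _ := norm_add_le _ _
        _ ≤ _ := by linarith
  have hY := isTraj_intTraj hF hB hy hyR
  have hZ := isTraj_intTraj hF hB hz hzR
  have hyi : IntTraj F t T (L * M) w := by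
    intro a b ha hab hb q
    rcases le_total b s with h1 | h1
    · rw [hwy b h1, hwy a (hab.trans h1)]
      exact hY a b ha hab hb q
    rcases le_total s a with h2 | h2
    · rw [hwz b h1, hwz a h2]
      exact hZ a b h2 hab hb q
    · have e1 := hY a s ha h2 hsT q
      have e2 := hZ s b le_rfl h1 hb q
      have e3 := hB.ham_lip (hyR s ⟨hts, hsT⟩) (hyR a ⟨ha, h2.trans hsT⟩) q
      have e4 := isTraj_norm_sub_le hB hy hyR ha h2 hsT
      rw [hwz b h1, hwy a h2]
      have e5 : z b - y a = (z b - z s) + (y s - y a) := by rw [hyz]; abel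
      rw [e5, inner_add_left]
      rw [← hyz] at e2 ⊢
      have e6 : L * ‖y s - y a‖ * ‖q‖ ≤ L * M * (s - a) * ‖q‖ := by
        have := mul_le_mul_of_nonneg_left e4 hL
        nlinarith [norm_nonneg q]
      have e7 : (b - s) * Ham F (y s) q ≤
          (b - s) * (Ham F (y a) q + L * M * (s - a) * ‖q‖) :=
        mul_le_mul_of_nonneg_left (by linarith) (by linarith)
      have e8 : 0 ≤ L * M * ‖q‖ * ((b - s) * (s - a)) := by
        have : 0 ≤ (b - s) * (s - a) := mul_nonneg (by linarith) (by linarith)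
        positivity
      nlinarith
  exact ⟨w, deriv w, hyi.isTraj hF (hts.trans hsT) hM hlip, hwy t hts, hwz T hsT⟩

end Arcs

section Euler

variable {F : E → Set E} {h : ℝ} {N : ℕ} {z : ℕ → E}

/-- `z` is an Euler polygon with step `h` and `N` steps for the inclusion `y' ∈ F y`. -/
def IsEuler (F : E → Set E) (h : ℝ) (N : ℕ) (z : ℕ → E) : Prop :=
  ∀ k < N, ∃ v ∈ F (z k), z (k + 1) = z k + h • v

theorem IsEuler.cons {w v : E} (hv : v ∈ F w) (hz : IsEuler F h N z) (h0 : z 0 = w + h • v) :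
    IsEuler F h (N + 1) (fun k => Nat.casesOn k w z) := by
  rintro (_ | k) hk
  · exact ⟨v, hv, h0⟩
  · exact hz k (by omega)

theorem IsEuler.tail (hz : IsEuler F h (N + 1) z) : IsEuler F h N (fun k => z (k + 1)) :=
  fun k hk => hz (k + 1) (by omega)

theorem IsEuler.norm_le (hz : IsEuler F h N z) (hh : 0 ≤ h) {r : ℝ}
    (hgrow : ∀ x : E, ∀ v ∈ F x, ‖v‖ ≤ r * (1 + ‖x‖)) :
    ∀ k ≤ N, 1 + ‖z k‖ ≤ Real.exp (r * h * k) * (1 + ‖z 0‖) := by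
  intro k
  induction k with
  | zero => simp
  | succ k ih =>
    intro hk
    obtain ⟨v, hv, e⟩ := hz k (by omega)
    have h1 : ‖z (k + 1)‖ ≤ ‖z k‖ + h * (r * (1 + ‖z k‖)) := by
      rw [e]
      refine (norm_add_le _ _).trans ?_
      rw [norm_smul, Real.norm_of_nonneg hh]
      gcongr
      exact hgrow _ v hv
    have h2 : 1 + r * h ≤ Real.exp (r * h) := by
      linarith [Real.add_one_le_exp (r * h)]
    calc 1 + ‖z (k + 1)‖ ≤ (1 + r * h) * (1 + ‖z k‖) := by linarith
      _ ≤ Real.exp (r * h) * (Real.exp (r * h * k) * (1 + ‖z 0‖)) := by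
        gcongr
        exact ih (by omega)
      _ = _ := by
        rw [← mul_assoc, ← Real.exp_add]
        push_cast
        ring_nf

theorem exists_isEuler_of_selection (h : ℝ) (w : E) (f : ℕ → E → E) (hf : ∀ k x, f k x ∈ F x) :
    ∃ z : ℕ → E, z 0 = w ∧ (∀ k, z (k + 1) = z k + h • f k (z k)) ∧ ∀ N, IsEuler F h N z := by
  let z : ℕ → E := fun k => Nat.rec w (fun k x => x + h • f k x) k
  exact ⟨z, rfl, fun k => rfl, fun N k _ => ⟨f k (z k), hf _ _, rfl⟩⟩

/-- Discrete Gronwall inequality. -/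
theorem le_exp_mul_of_le_add {e : ℕ → ℝ} {a b : ℝ} (ha : 0 ≤ a) (hb : 0 ≤ b)
    (he0 : 0 ≤ e 0) (he : ∀ k < N, e (k + 1) ≤ (1 + a) * e k + b) :
    ∀ k ≤ N, e k ≤ Real.exp (a * k) * (e 0 + k * b) := by
  intro k
  induction k with
  | zero => simp
  | succ k ih =>
    intro hk
    have h1 := ih (by omega)
    have h2 : 1 + a ≤ Real.exp a := by linarith [Real.add_one_le_exp a]
    have h3 : 1 ≤ Real.exp (a * (k + 1 : ℕ)) := Real.one_le_exp (by positivity)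
    calc e (k + 1) ≤ (1 + a) * e k + b := he k (by omega)
      _ ≤ (1 + a) * (Real.exp (a * k) * (e 0 + k * b)) + 1 * b := by
        rw [one_mul]
        gcongr
      _ ≤ Real.exp a * (Real.exp (a * k) * (e 0 + k * b)) + Real.exp (a * (k + 1 : ℕ)) * b := by
        gcongr
      _ = _ := by
        rw [← mul_assoc, ← Real.exp_add]
        push_cast
        ring_nf

/-- Trajectories are approximated by Euler polygons. -/
theorem exists_isEuler_near (hF : ∀ x, (F x).Nonempty ∧ Convex ℝ (F x) ∧ IsCompact (F x))
    {R L c M C t T : ℝ} (hB : LocalBounds F R L c M) (htT : t ≤ T) {η : ℝ → E} (hC : 0 ≤ C)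
    (hη : IntTraj F t T C η) (hηR : ∀ s ∈ Icc t T, ‖η s‖ ≤ R)
    (hηM : ∀ a b, t ≤ a → a ≤ b → b ≤ T → ‖η b - η a‖ ≤ M * (b - a)) (hN : 0 < N)
    (hh : 0 ≤ h) {w : E} (hw : ∀ z, IsEuler F h N z → z 0 = w → ∀ k ≤ N, ‖z k‖ ≤ R) :
    ∃ ζ, IsEuler F h N ζ ∧ ζ 0 = w ∧ ‖ζ N - η T‖ ≤ Real.exp (L * h * N) *
      (‖w - η t‖ + N * (h * (C * ((T - t) / N)) + |h - (T - t) / N| * M)) := by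
  set h' := (T - t) / N with hh'
  have hN' : (0:ℝ) < N := by exact_mod_cast hN
  have hL := hB.L_nonneg
  have hM := hB.M_nonneg
  have hh'0 : 0 ≤ h' := div_nonneg (by linarith) hN'.le
  have hNh' : N * h' = T - t := by rw [hh']; field_simp
  set s : ℕ → ℝ := fun k => t + k * h' with hs
  have hsN : s N = T := by simp [hs, hNh']
  have hs0 : s 0 = t := by simp [hs]
  have hsucc : ∀ k, s (k + 1) = s k + h' := fun k => by simp only [hs]; push_cast; ring
  have hst : ∀ k, t ≤ s k := fun k => by simp only [hs]; nlinarith [k.cast_nonneg (α := ℝ)]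
  have hsT : ∀ k ≤ N, s k ≤ T := fun k hk => by
    rw [← hsN]
    simp only [hs]
    gcongr
  have hv : ∀ k : ℕ, ∃ v : E, k < N → η (s (k + 1)) - η (s k) = h' • v ∧ ‖v‖ ≤ M ∧
      ∀ q, ⟪v, q⟫ ≤ Ham F (η (s k)) q + C * h' * ‖q‖ := by
    intro k
    by_cases hk : k < N
    swap
    · exact ⟨0, fun h => absurd h hk⟩
    rcases hh'0.eq_or_lt with h0 | h0
    · obtain ⟨v, hv⟩ := (hF (η (s k))).1
      refine ⟨v, fun _ => ⟨by rw [hsucc, ← h0]; simp, ?_, fun q => ?_⟩⟩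
      · exact hB.norm_le (hηR _ ⟨hst k, hsT k hk.le⟩) v hv
      · rw [← h0]
        simpa using inner_le_ham (q := q) (hF _).2.2 hv
    · refine ⟨h'⁻¹ • (η (s (k + 1)) - η (s k)), fun _ => ⟨?_, ?_, fun q => ?_⟩⟩
      · rw [smul_inv_smul₀ h0.ne']
      · have := hηM (s k) (s (k + 1)) (hst k) (by rw [hsucc]; linarith) (hsT _ hk)
        rw [norm_smul, norm_inv, Real.norm_of_nonneg hh'0, inv_mul_le_iff₀ h0]
        rw [hsucc k] at this ⊢
        linarith
      · have := hη (s k) (s (k + 1)) (hst k) (by rw [hsucc]; linarith) (hsT _ hk) q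
        rw [real_inner_smul_left, inv_mul_le_iff₀ h0]
        rw [hsucc k] at this ⊢
        rwa [add_sub_cancel_left] at this
  choose v hv using hv
  have hf : ∀ k : ℕ, ∀ x : E, ∃ u ∈ F x, k < N → ‖x‖ ≤ R →
      ‖v k - u‖ ≤ L * ‖η (s k) - x‖ + C * h' := by
    intro k x
    by_cases hk : k < N ∧ ‖x‖ ≤ R
    swap
    · obtain ⟨u, hu⟩ := (hF x).1
      exact ⟨u, hu, fun h1 h2 => absurd ⟨h1, h2⟩ hk⟩
    obtain ⟨u, hu, hle⟩ := exists_mem_norm_sub_le (v := v k) (hF x).1 (hF x).2.1 (hF x).2.2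
      (δ := L * ‖η (s k) - x‖ + C * h') (by positivity) fun q => by
        have h1 := (hv k hk.1).2.2 q
        have h2 := hB.ham_lip (hηR _ ⟨hst k, hsT k hk.1.le⟩) hk.2 q
        linarith
    exact ⟨u, hu, fun _ _ => hle⟩
  choose f hfF hf using hf
  obtain ⟨ζ, hζ0, hζs, hζ⟩ := exists_isEuler_of_selection h w f hfF
  have hζR := hw ζ (hζ N) hζ0
  refine ⟨ζ, hζ N, hζ0, ?_⟩
  have key := le_exp_mul_of_le_add (N := N) (e := fun k => ‖ζ k - η (s k)‖) (a := L * h)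
    (b := h * (C * h') + |h - h'| * M) (by positivity) (by positivity) (norm_nonneg _)
    (fun k hk => by
      obtain ⟨h1, h2, -⟩ := hv k hk
      have h3 := hf k (ζ k) hk (hζR k hk.le)
      have h4 : ζ (k + 1) - η (s (k + 1)) =
          (ζ k - η (s k)) - h • (v k - f k (ζ k)) + (h - h') • v k := by
        rw [hζs, ← sub_add_cancel (η (s (k + 1))) (η (s k)), h1]
        module
      rw [h4]
      refine (norm_add_le _ _).trans ((add_le_add_left (norm_sub_le _ _) _).trans ?_)
      rw [norm_smul, norm_smul, Real.norm_of_nonneg hh, Real.norm_eq_abs]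
      rw [norm_sub_rev (η (s k))] at h3
      have h5 := mul_le_mul_of_nonneg_left h3 hh
      have h6 := mul_le_mul_of_nonneg_left h2 (abs_nonneg (h - h'))
      linarith) N le_rfl
  simp only [hsN, hs0, hζ0] at key
  exact key

/-- The graph of `F` over a closed ball is closed. -/
theorem isClosed_graph (hF : ∀ x, (F x).Nonempty ∧ Convex ℝ (F x) ∧ IsCompact (F x))
    {R L c M : ℝ} (hB : LocalBounds F R L c M) :
    IsClosed {a : E × E | ‖a.1‖ ≤ R ∧ a.2 ∈ F a.1} := by
  refine IsSeqClosed.isClosed fun u a hu ha => ?_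
  have h1 : Tendsto (fun n => (u n).1) atTop (𝓝 a.1) := (continuous_fst.tendsto _).comp ha
  have h2 : Tendsto (fun n => (u n).2) atTop (𝓝 a.2) := (continuous_snd.tendsto _).comp ha
  have hR : ‖a.1‖ ≤ R := le_of_tendsto h1.norm (Eventually.of_forall fun n => (hu n).1)
  refine ⟨hR, mem_of_forall_inner_le_ham (hF _).1 (hF _).2.1 (hF _).2.2 fun q => ?_⟩
  have h3 : Tendsto (fun n => Ham F a.1 q + L * ‖(u n).1 - a.1‖ * ‖q‖) atTop
      (𝓝 (Ham F a.1 q + L * ‖a.1 - a.1‖ * ‖q‖)) :=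
    (((h1.sub_const _).norm.const_mul L).mul_const _).const_add _
  rw [sub_self, norm_zero, mul_zero, zero_mul, add_zero] at h3
  refine le_of_tendsto_of_tendsto' (h2.inner tendsto_const_nhds) h3 fun n => ?_
  exact (inner_le_ham (hF _).2.2 (hu n).2).trans (hB.ham_lip (hu n).1 hR q)

theorem exists_isEuler_minimizer [FiniteDimensional ℝ E]
    (hF : ∀ x, (F x).Nonempty ∧ Convex ℝ (F x) ∧ IsCompact (F x)) {R L c M : ℝ}
    (hB : LocalBounds F R L c M) (hh : 0 < h) {K : Set E} (hK : IsCompact K) (hKne : K.Nonempty)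
    (hR : ∀ z, IsEuler F h N z → z 0 ∈ K → ∀ k ≤ N, ‖z k‖ ≤ R) {φ ψ : E → ℝ}
    (hφ : Continuous φ) (hψ : Continuous ψ) :
    ∃ z, IsEuler F h N z ∧ z 0 ∈ K ∧ ∀ z', IsEuler F h N z' → z' 0 ∈ K →
      φ (z N) + ψ (z 0) ≤ φ (z' N) + ψ (z' 0) := by
  set S : Set (ℕ → E) := {z | (∀ k, z k ∈ closedBall (0:E) R) ∧ z 0 ∈ K ∧
    ∀ k < N, (z k, h⁻¹ • (z (k + 1) - z k)) ∈ {a : E × E | ‖a.1‖ ≤ R ∧ a.2 ∈ F a.1}} with hS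
  have hSc : IsCompact S := by
    refine (isCompact_univ_pi fun _ : ℕ => isCompact_closedBall (0:E) R).of_isClosed_subset ?_
      fun z hz k _ => hz.1 k
    have h1 : IsClosed {z : ℕ → E | ∀ k, z k ∈ closedBall (0:E) R} := by
      rw [ofPred_forall]
      exact isClosed_iInter fun k => isClosed_closedBall.preimage (continuous_apply k)
    have h2 : IsClosed {z : ℕ → E | ∀ k < N, (z k, h⁻¹ • (z (k + 1) - z k)) ∈
        {a : E × E | ‖a.1‖ ≤ R ∧ a.2 ∈ F a.1}} := by
      simp only [ofPred_forall]
      refine isClosed_iInter fun k => isClosed_iInter fun _ => ?_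
      exact (isClosed_graph hF hB).preimage (by fun_prop)
    exact h1.inter ((hK.isClosed.preimage (continuous_apply 0)).inter h2)
  have hES : ∀ z, IsEuler F h N z → z 0 ∈ K → (fun k => z (min k N)) ∈ S := by
    intro z hz h0
    refine ⟨fun k => by simpa using hR z hz h0 _ (min_le_right k N), by simpa using h0,
      fun k hk => ⟨hR z hz h0 _ (min_le_right k N), ?_⟩⟩
    obtain ⟨v, hv, e⟩ := hz k hk
    simp only
    rw [min_eq_left hk.le, min_eq_left (Nat.succ_le_of_lt hk), e, add_sub_cancel_left,
      inv_smul_smul₀ hh.ne']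
    exact hv
  have hne : S.Nonempty := by
    obtain ⟨w, hw⟩ := hKne
    choose f hf using fun x => (hF x).1
    obtain ⟨z, hz0, -, hz⟩ := exists_isEuler_of_selection h w (fun _ => f) fun _ => hf
    exact ⟨_, hES z (hz N) (hz0 ▸ hw)⟩
  obtain ⟨z, hzS, hz⟩ := hSc.exists_isMinOn hne
    (f := fun z => φ (z N) + ψ (z 0)) (by fun_prop)
  refine ⟨z, fun k hk => ⟨_, (hzS.2.2 k hk).2, ?_⟩, hzS.2.1, fun z' hz' h0 => ?_⟩
  · rw [smul_inv_smul₀ hh.ne', add_sub_cancel]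
  · have := hz (hES z' hz' h0)
    simpa using this

end Euler

section DiscreteMaximumPrinciple

variable {F : E → Set E} {φ : E → ℝ} {h : ℝ} {N : ℕ} {z p : ℕ → E}

/-- `-p` is a supergradient at `w` of the optimal cost of `m`-step Euler polygons, whose value at
`w` is `c₀`. -/
def EulerSuper (F : E → Set E) (φ : E → ℝ) (h : ℝ) (m : ℕ) (w : E) (c₀ : ℝ) (p : E) : Prop :=
  ∀ ε > (0:ℝ), ∀ᶠ w' in 𝓝 w, ∃ z, IsEuler F h m z ∧ z 0 = w' ∧
    φ (z m) ≤ c₀ - ⟪p, w' - w⟫ + ε * ‖w' - w‖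

theorem eulerSuper_zero {w g : E} (hg : HasGradientAt φ g w) :
    EulerSuper F φ h 0 w (φ w) (-g) := by
  intro ε hε
  filter_upwards [(hasGradientAt_iff_isLittleO.1 hg).def hε] with w' hw'
  refine ⟨fun _ => w', fun k hk => absurd hk (by omega), rfl, ?_⟩
  have := (abs_le.1 hw').2
  rw [inner_neg_left]
  linarith

theorem EulerSuper.inner_eq_ham (hF : ∀ x, (F x).Nonempty ∧ Convex ℝ (F x) ∧ IsCompact (F x))
    (hh : 0 < h) {m : ℕ} {w v q : E} {c₀ : ℝ} (hv : v ∈ F w)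
    (hs : EulerSuper F φ h m (w + h • v) c₀ q)
    (hopt : ∀ z, IsEuler F h (m + 1) z → z 0 = w → c₀ ≤ φ (z (m + 1))) :
    ⟪v, q⟫ = Ham F w q := by
  refine le_antisymm (inner_le_ham (hF w).2.2 hv)
    (ham_le_of_forall_inner_le (hF w).1 (hF w).2.2 fun v' hv' => ?_)
  have key : ∀ ε > (0:ℝ), ⟪v', q⟫ ≤ ⟪v, q⟫ + ε * ‖v' - v‖ := by
    intro ε hε
    have hc : Tendsto (fun θ : ℝ => w + h • (v + θ • (v' - v))) (𝓝[>] 0) (𝓝 (w + h • v)) := by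
      have : Continuous fun θ : ℝ => w + h • (v + θ • (v' - v)) := by fun_prop
      simpa using (this.tendsto 0).mono_left nhdsWithin_le_nhds
    obtain ⟨θ, ⟨z, hz, hz0, hle⟩, hθ0, hθ1⟩ :=
      ((hc.eventually (hs ε hε)).and (Ioc_mem_nhdsGT (zero_lt_one' ℝ))).exists
    have hmem : v + θ • (v' - v) ∈ F w := (hF w).2.1.add_smul_sub_mem hv hv' ⟨hθ0.le, hθ1⟩
    have h1 := hopt _ (hz.cons hmem hz0) rfl
    have h2 : w + h • (v + θ • (v' - v)) - (w + h • v) = (h * θ) • (v' - v) := by module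
    rw [h2, norm_smul, real_inner_smul_right, Real.norm_of_nonneg (by positivity),
      inner_sub_right] at hle
    have h3 : h * θ * (⟪q, v'⟫ - ⟪q, v⟫) ≤ h * θ * (ε * ‖v' - v‖) := by
      simp only at h1
      linarith
    have := le_of_mul_le_mul_left h3 (by positivity)
    rw [real_inner_comm v', real_inner_comm v] at this
    linarith
  have h1 : Tendsto (fun ε : ℝ => ⟪v, q⟫ + ε * ‖v' - v‖) (𝓝[>] 0) (𝓝 ⟪v, q⟫) := by
    have : Continuous fun ε : ℝ => ⟪v, q⟫ + ε * ‖v' - v‖ := by fun_prop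
    simpa using (this.tendsto 0).mono_left nhdsWithin_le_nhds
  exact ge_of_tendsto h1 (by filter_upwards [self_mem_nhdsWithin] with ε hε using key ε hε)

theorem EulerSuper.succ {R L c M : ℝ} (hB : LocalBounds F R L c M) (hh : 0 < h) {m : ℕ}
    {w v q ζ : E} {c₀ k : ℝ} (hw : ‖w‖ < R) (hv : v ∈ F w)
    (hs : EulerSuper F φ h m (w + h • v) c₀ q) (hmax : ⟪v, q⟫ = Ham F w q)
    (hζ : ∀ u, ‖u‖ < R → Ham F w q + ⟪ζ, u - w⟫ - k * ‖u - w‖ ^ 2 ≤ Ham F u q) :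
    EulerSuper F φ h (m + 1) w c₀ (q + h • ζ) := by
  intro ε hε
  have hL := hB.L_nonneg
  have hball : ∀ᶠ u in 𝓝 w, ‖u‖ < R :=
    continuous_norm.continuousAt.eventually_lt continuousAt_const hw
  choose! f hf using fun u (hu : ‖u‖ ≤ R) => hB.exists_selection hw.le hu q v hv hmax
  have hc : Tendsto (fun u => u + h • f u) (𝓝 w) (𝓝 (w + h • v)) := by
    refine tendsto_id.add (Tendsto.const_smul ?_ h)
    rw [tendsto_iff_norm_sub_tendsto_zero]
    have h0 : Tendsto (fun u => L * ‖u - w‖) (𝓝 w) (𝓝 0) := by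
      have : Continuous fun u => L * ‖u - w‖ := by fun_prop
      simpa using this.tendsto w
    refine squeeze_zero' (Eventually.of_forall fun _ => norm_nonneg _) ?_ h0
    filter_upwards [hball] with u hu using (hf u hu.le).2.2
  have hsmall : ∀ᶠ u in 𝓝 w, h * (|k| * ‖u - w‖) < ε / 2 := by
    have : ContinuousAt (fun u => h * (|k| * ‖u - w‖)) w := by fun_prop
    exact this.eventually_lt continuousAt_const (by simpa using hε)
  filter_upwards [hball, hc.eventually (hs (ε / (2 * (1 + h * L))) (by positivity)), hsmall]
    with u hu ⟨z, hz, hz0, hle⟩ hsm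
  obtain ⟨hfu, hfe, hfl⟩ := hf u hu.le
  refine ⟨_, hz.cons hfu hz0, rfl, hle.trans ?_⟩
  have h1 : u + h • f u - (w + h • v) = (u - w) + h • (f u - v) := by module
  have h2 : ‖u + h • f u - (w + h • v)‖ ≤ (1 + h * L) * ‖u - w‖ := by
    rw [h1]
    refine (norm_add_le _ _).trans ?_
    rw [norm_smul, Real.norm_of_nonneg hh.le]
    nlinarith
  have h3 : ε / (2 * (1 + h * L)) * ‖u + h • f u - (w + h • v)‖ ≤ ε / 2 * ‖u - w‖ := by
    refine (mul_le_mul_of_nonneg_left h2 (by positivity)).trans_eq ?_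
    field_simp
  have h4 := hζ u hu
  have h5 : ⟪q, u + h • f u - (w + h • v)⟫ = ⟪q, u - w⟫ + h * (Ham F u q - Ham F w q) := by
    rw [h1, inner_add_right, real_inner_smul_right, inner_sub_right q (f u), real_inner_comm (f u),
      real_inner_comm v, hfe, hmax]
  have h6 : h * (k * ‖u - w‖ ^ 2) ≤ ε / 2 * ‖u - w‖ := by
    have e1 : k * ‖u - w‖ ^ 2 ≤ |k| * ‖u - w‖ ^ 2 := by gcongr; exact le_abs_self k
    have e2 := mul_le_mul_of_nonneg_right hsm.le (norm_nonneg (u - w))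
    have e3 := mul_le_mul_of_nonneg_left e1 hh.le
    linarith
  rw [h5, inner_add_left, real_inner_smul_left]
  have h7 := mul_le_mul_of_nonneg_left h4 hh.le
  linarith

/-- The discrete Hamiltonian system satisfied by optimal Euler polygons. -/
structure IsExtremal (F : E → Set E) (h : ℝ) (N : ℕ) (R c : ℝ) (z p : ℕ → E) : Prop where
  velocity : ∀ k < N, ∃ v ∈ F (z k), z (k + 1) = z k + h • v ∧
    ⟪v, p (k + 1)⟫ = Ham F (z k) (p (k + 1))
  adjoint : ∀ k < N, ∃ ζ, p k = p (k + 1) + h • ζ ∧ ∀ w, ‖w‖ < R →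
    Ham F (z k) (p (k + 1)) + ⟪ζ, w - z k⟫ - c * ‖p (k + 1)‖ * ‖w - z k‖ ^ 2 ≤
      Ham F w (p (k + 1))

/-- The discrete maximum principle. -/
theorem exists_isExtremal (hF : ∀ x, (F x).Nonempty ∧ Convex ℝ (F x) ∧ IsCompact (F x))
    {R L c M : ℝ} (hB : LocalBounds F R L c M) (hh : 0 < h) (hφ : Differentiable ℝ φ) :
    ∀ {N : ℕ} {z : ℕ → E}, IsEuler F h N z → (∀ k ≤ N, ‖z k‖ < R) →
      (∀ z', IsEuler F h N z' → z' 0 = z 0 → φ (z N) ≤ φ (z' N)) →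
      ∃ p : ℕ → E, p N = -gradient φ (z N) ∧ IsExtremal F h N R c z p ∧
        EulerSuper F φ h N (z 0) (φ (z N)) (p 0) := by
  intro N
  induction N with
  | zero =>
    intro z _ _ _
    exact ⟨fun _ => -gradient φ (z 0), rfl, ⟨by simp, by simp⟩,
      eulerSuper_zero (hφ _).hasGradientAt⟩
  | succ N ih =>
    intro z hz hzR hopt
    obtain ⟨v, hv, e⟩ := hz 0 (by omega)
    obtain ⟨p, hpN, hp, hs⟩ := ih hz.tail (fun k hk => hzR (k + 1) (by omega))
      (fun z' hz' h0 => hopt _ (hz'.cons hv (h0.trans e)) rfl)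
    simp only [e] at hs
    rw [zero_add] at e
    have hmax := hs.inner_eq_ham hF hh hv hopt
    obtain ⟨ζ, hζ⟩ := hB.exists_subgradient (hzR 0 (by omega)) (p 0)
    refine ⟨fun k => Nat.casesOn k (p 0 + h • ζ) p, hpN, ⟨?_, ?_⟩,
      hs.succ hB hh (hzR 0 (by omega)) hv hmax hζ⟩
    · rintro (_ | k) hk
      · exact ⟨v, hv, e, hmax⟩
      · exact hp.velocity k (by omega)
    · rintro (_ | k) hk
      · exact ⟨ζ, rfl, hζ⟩
      · exact hp.adjoint k (by omega)

/-- Transversality at the initial point. -/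
theorem EulerSuper.eq_of_isMin {w q g : E} {c₀ ρ : ℝ} {ξ : E} {ψ : E → ℝ}
    (hs : EulerSuper F φ h N w c₀ q) (hg : HasGradientAt ψ g w) (hw : w ∈ ball ξ ρ)
    (hmin : ∀ z, IsEuler F h N z → z 0 ∈ closedBall ξ ρ → c₀ + ψ w ≤ φ (z N) + ψ (z 0)) :
    q = g := by
  have hev : ∀ ε > (0:ℝ), ∀ᶠ w' in 𝓝 w, ⟪q - g, w' - w⟫ ≤ ε * ‖w' - w‖ := by
    intro ε hε
    filter_upwards [hs (ε / 2) (half_pos hε),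
      (hasGradientAt_iff_isLittleO.1 hg).def (half_pos hε), isOpen_ball.mem_nhds hw]
      with w' ⟨z, hz, hz0, hle⟩ h2 h3
    have h4 := hmin z hz (hz0 ▸ ball_subset_closedBall h3)
    rw [hz0] at h4
    have := (abs_le.1 h2).2
    rw [inner_sub_left]
    linarith
  by_contra hne
  have hpos : 0 < ‖q - g‖ := norm_pos_iff.2 (sub_ne_zero.2 hne)
  have hc : Tendsto (fun θ : ℝ => w + θ • (q - g)) (𝓝[>] 0) (𝓝 w) := by
    have : Continuous fun θ : ℝ => w + θ • (q - g) := by fun_prop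
    simpa using (this.tendsto 0).mono_left nhdsWithin_le_nhds
  obtain ⟨θ, hθ, hθ0⟩ := ((hc.eventually (hev (‖q - g‖ / 2) (by positivity))).and
    self_mem_nhdsWithin).exists
  rw [add_sub_cancel_left, real_inner_smul_right, real_inner_self_eq_norm_mul_norm, norm_smul,
    Real.norm_of_nonneg (le_of_lt hθ0)] at hθ
  have : 0 < θ * (‖q - g‖ * ‖q - g‖) := mul_pos hθ0 (by positivity)
  nlinarith

theorem IsExtremal.norm_adjoint_sub_le {R L c M : ℝ} (hB : LocalBounds F R L c M)
    (hp : IsExtremal F h N R c z p) (hh : 0 ≤ h) (hzR : ∀ k ≤ N, ‖z k‖ + 1 < R) {k : ℕ}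
    (hk : k < N) : ‖p k - p (k + 1)‖ ≤ h * ((L + c) * ‖p (k + 1)‖) := by
  obtain ⟨ζ, e, hζ⟩ := hp.adjoint k hk
  rw [e, add_sub_cancel_left, norm_smul, Real.norm_of_nonneg hh]
  exact mul_le_mul_of_nonneg_left (hB.norm_subgradient_le (hzR k hk.le) hζ) hh

theorem IsExtremal.norm_adjoint_le {R L c M : ℝ} (hB : LocalBounds F R L c M)
    (hp : IsExtremal F h N R c z p) (hh : 0 ≤ h) (hzR : ∀ k ≤ N, ‖z k‖ + 1 < R) {j k : ℕ}
    (hjk : j ≤ k) (hk : k ≤ N) : ‖p j‖ ≤ Real.exp ((L + c) * (h * (k - j))) * ‖p k‖ := by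
  have hLc : 0 ≤ L + c := add_nonneg hB.L_nonneg hB.c_nonneg
  induction k, hjk using Nat.le_induction with
  | base => simp
  | succ k hjk ih =>
    have h1 := hp.norm_adjoint_sub_le hB hh hzR (k := k) (by omega)
    have h2 : ‖p k‖ ≤ (1 + (L + c) * h) * ‖p (k + 1)‖ := by
      have := norm_le_norm_add_norm_sub (p (k + 1)) (p k)
      rw [norm_sub_rev] at this
      linarith
    have h3 : 1 + (L + c) * h ≤ Real.exp ((L + c) * h) := by
      linarith [Real.add_one_le_exp ((L + c) * h)]
    calc ‖p j‖ ≤ Real.exp ((L + c) * (h * (k - j))) * ‖p k‖ := ih (by omega)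
      _ ≤ Real.exp ((L + c) * (h * (k - j))) * (Real.exp ((L + c) * h) * ‖p (k + 1)‖) := by
        gcongr
        exact h2.trans (by gcongr)
      _ = _ := by
        rw [← mul_assoc, ← Real.exp_add]
        push_cast
        ring_nf

end DiscreteMaximumPrinciple

section MeshLimit

variable {F : E → Set E} {t T : ℝ} {h : ℕ → ℝ} {N : ℕ → ℕ} {z p : ℕ → ℕ → E} {y q : ℝ → E}

theorem tendsto_ham (hF : ∀ x, (F x).Nonempty ∧ Convex ℝ (F x) ∧ IsCompact (F x))
    {R L c M : ℝ} (hB : LocalBounds F R L c M) {ι : Type*} {l : Filter ι} {u v : ι → E} {x w : E}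
    (hu : Tendsto u l (𝓝 x)) (hv : Tendsto v l (𝓝 w)) (huR : ∀ᶠ i in l, ‖u i‖ ≤ R)
    (hx : ‖x‖ ≤ R) : Tendsto (fun i => Ham F (u i) (v i)) l (𝓝 (Ham F x w)) := by
  rw [tendsto_iff_norm_sub_tendsto_zero]
  have h0 : Tendsto (fun i => L * ‖u i - x‖ * ‖w‖ + M * ‖v i - w‖) l (𝓝 0) := by
    have h1 := (tendsto_iff_norm_sub_tendsto_zero.1 hu)
    have h2 := (tendsto_iff_norm_sub_tendsto_zero.1 hv)
    simpa using ((h1.const_mul L).mul_const ‖w‖).add (h2.const_mul M)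
  refine squeeze_zero' (Eventually.of_forall fun _ => norm_nonneg _) ?_ h0
  filter_upwards [huR] with i hi
  have h1 := hB.ham_lip hi hx w
  have h2 := hB.ham_lip hx hi w
  have h3 := ham_sub_le (hF (u i)).1 (hF (u i)).2.2 (hB.norm_le hi) (v i) w
  have h4 := ham_sub_le (hF (u i)).1 (hF (u i)).2.2 (hB.norm_le hi) w (v i)
  rw [norm_sub_rev x] at h2
  rw [norm_sub_rev w] at h4
  rw [Real.norm_eq_abs, abs_le]
  constructor <;> linarith

theorem exists_tendsto_ultrafilter [FiniteDimensional ℝ E] {ι : Type*} (U : Ultrafilter ι)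
    {u : ι → E} {R : ℝ} (hu : ∀ᶠ i in U, ‖u i‖ ≤ R) : ∃ x, ‖x‖ ≤ R ∧ Tendsto u U (𝓝 x) := by
  obtain ⟨x, hx, hle⟩ := (isCompact_closedBall (0:E) R).ultrafilter_le_nhds (U.map u)
    (le_principal_iff.2 (mem_map.2 (hu.mono fun i hi => by simpa using hi)))
  exact ⟨x, by simpa using hx, hle⟩

theorem tendsto_gradpH [FiniteDimensional ℝ E]
    (hF : ∀ x, (F x).Nonempty ∧ Convex ℝ (F x) ∧ IsCompact (F x)) (hH1 : HypH1 F)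
    {R L c M : ℝ} (hB : LocalBounds F R L c M) {ι : Type*} {l : Filter ι} {u v : ι → E} {x w : E}
    (hu : Tendsto u l (𝓝 x)) (hv : Tendsto v l (𝓝 w)) (huR : ∀ᶠ i in l, ‖u i‖ ≤ R)
    (hx : ‖x‖ ≤ R) (hw : w ≠ 0) :
    Tendsto (fun i => gradpH F (u i) (v i)) l (𝓝 (gradpH F x w)) := by
  rw [tendsto_iff_ultrafilter]
  intro U hU
  have hmem : ∀ᶠ i in U, ‖u i‖ ≤ R ∧ gradpH F (u i) (v i) ∈ F (u i) ∧
      ⟪gradpH F (u i) (v i), v i⟫ = Ham F (u i) (v i) := by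
    filter_upwards [hU huR, hU (hv.eventually_ne hw)] with i h1 h2
    exact ⟨h1, gradpH_mem (hF _).1 (hF _).2.2 (hH1.2.1 _ _ h2)⟩
  obtain ⟨g, -, hg⟩ := exists_tendsto_ultrafilter U
    (hmem.mono fun i hi => hB.norm_le hi.1 _ hi.2.1)
  have h1 : g ∈ F x := ((isClosed_graph hF hB).mem_of_tendsto
    ((hu.mono_left hU).prodMk_nhds hg) (hmem.mono fun i hi => ⟨hi.1, hi.2.1⟩)).2
  have h2 : ⟪g, w⟫ = Ham F x w := by
    refine tendsto_nhds_unique (hg.inner (hv.mono_left hU)) ?_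
    exact (tendsto_ham hF hB (hu.mono_left hU) (hv.mono_left hU) (hU huR) hx).congr'
      (hmem.mono fun i hi => hi.2.2.symm)
  rwa [← eq_of_hasGradientAt_ham (hF x).2.2 (hH1.2.1 x w hw) h1 h2]

/-- Uniform meshes whose step tends to zero and whose total length tends to `T - t`. -/
structure IsMesh (t T : ℝ) (h : ℕ → ℝ) (N : ℕ → ℕ) : Prop where
  lt : t < T
  pos : ∀ i, 0 < h i
  tendsto_zero : Tendsto h atTop (𝓝 0)
  tendsto_mul : Tendsto (fun i => h i * N i) atTop (𝓝 (T - t))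

/-- The index of the node of an `N`-step mesh of `[t, T]` lying just before `s`. -/
def meshIndex (t T : ℝ) (N : ℕ) (s : ℝ) : ℕ := ⌊(s - t) / (T - t) * N⌋₊

theorem meshIndex_left (N : ℕ) : meshIndex t T N t = 0 := by simp [meshIndex]

theorem meshIndex_right (htT : t < T) (N : ℕ) : meshIndex t T N T = N := by
  rw [meshIndex, div_self (by linarith), one_mul, Nat.floor_natCast]

theorem meshIndex_mono (htT : t < T) (N : ℕ) {a b : ℝ} (hab : a ≤ b) :
    meshIndex t T N a ≤ meshIndex t T N b := by
  have : 0 < T - t := by linarith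
  unfold meshIndex
  gcongr

theorem meshIndex_le (htT : t < T) (N : ℕ) {b : ℝ} (hb : b ≤ T) : meshIndex t T N b ≤ N :=
  (meshIndex_mono htT N hb).trans_eq (meshIndex_right htT N)

theorem IsMesh.tendsto_meshIndex (hm : IsMesh t T h N) {s : ℝ} (hs : t ≤ s) :
    Tendsto (fun i => h i * meshIndex t T (N i) s) atTop (𝓝 (s - t)) := by
  have hpos : 0 < T - t := by linarith [hm.lt]
  have h1 : Tendsto (fun i => (s - t) / (T - t) * (h i * N i)) atTop (𝓝 (s - t)) := by
    have := hm.tendsto_mul.const_mul ((s - t) / (T - t))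
    rwa [div_mul_cancel₀ _ hpos.ne'] at this
  have h2 : Tendsto (fun i => (s - t) / (T - t) * (h i * N i) - h i) atTop (𝓝 (s - t)) := by
    simpa using h1.sub hm.tendsto_zero
  have h0 : 0 ≤ (s - t) / (T - t) := div_nonneg (by linarith) hpos.le
  refine tendsto_of_tendsto_of_tendsto_of_le_of_le h2 h1 (fun i => ?_) fun i => ?_
  · have := mul_le_mul_of_nonneg_left (Nat.lt_floor_add_one ((s - t) / (T - t) * N i)).le
      (hm.pos i).le
    simp only [meshIndex]
    linarith
  · have := mul_le_mul_of_nonneg_left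
      (Nat.floor_le (mul_nonneg h0 (N i).cast_nonneg)) (hm.pos i).le
    simp only [meshIndex]
    linarith

theorem IsMesh.tendsto_meshIndex_sub (hm : IsMesh t T h N) {a b : ℝ} (ha : t ≤ a) (hb : t ≤ b) :
    Tendsto (fun i => h i * ((meshIndex t T (N i) b : ℝ) - meshIndex t T (N i) a))
      (hyperfilter ℕ) (𝓝 (b - a)) := by
  have := ((hm.tendsto_meshIndex hb).sub (hm.tendsto_meshIndex ha)).mono_left
    Nat.hyperfilter_le_atTop
  simpa [mul_sub] using this

/-- `y` is the pointwise limit along an ultrafilter of the polygons `z i`. -/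
def IsMeshLimit (t T : ℝ) (N : ℕ → ℕ) (z : ℕ → ℕ → E) (y : ℝ → E) : Prop :=
  ∀ s ∈ Icc t T, Tendsto (fun i => z i (meshIndex t T (N i) s)) (hyperfilter ℕ) (𝓝 (y s))

theorem exists_isMeshLimit [FiniteDimensional ℝ E] (htT : t < T) {R : ℝ}
    (hz : ∀ i, ∀ k ≤ N i, ‖z i k‖ ≤ R) : ∃ y, IsMeshLimit t T N z y := by
  have : ∀ s, ∃ x, s ∈ Icc t T →
      Tendsto (fun i => z i (meshIndex t T (N i) s)) (hyperfilter ℕ) (𝓝 x) := by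
    intro s
    by_cases hs : s ∈ Icc t T
    · obtain ⟨x, -, hx⟩ := exists_tendsto_ultrafilter (hyperfilter ℕ) (R := R)
        (u := fun i => z i (meshIndex t T (N i) s))
        (Eventually.of_forall fun i => hz i _ (meshIndex_le htT _ hs.2))
      exact ⟨x, fun _ => hx⟩
    · exact ⟨0, fun h => absurd h hs⟩
  choose y hy using this
  exact ⟨y, hy⟩

theorem IsMeshLimit.left (hy : IsMeshLimit t T N z y) (htT : t ≤ T) :
    Tendsto (fun i => z i 0) (hyperfilter ℕ) (𝓝 (y t)) := by
  simpa [meshIndex_left] using hy t ⟨le_rfl, htT⟩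

theorem IsMeshLimit.right (hy : IsMeshLimit t T N z y) (htT : t < T) :
    Tendsto (fun i => z i (N i)) (hyperfilter ℕ) (𝓝 (y T)) := by
  simpa [meshIndex_right htT] using hy T ⟨htT.le, le_rfl⟩

theorem IsMeshLimit.norm_le (hy : IsMeshLimit t T N z y) (htT : t < T) {R : ℝ}
    (hz : ∀ i, ∀ k ≤ N i, ‖z i k‖ ≤ R) {s : ℝ} (hs : s ∈ Icc t T) : ‖y s‖ ≤ R :=
  le_of_tendsto (hy s hs).norm
    (Eventually.of_forall fun i => hz i _ (meshIndex_le htT _ hs.2))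

theorem sub_le_of_forall_succ_sub_le {Q : ℕ → ℝ} {δ : ℝ} {j m : ℕ} (hjm : j ≤ m)
    (hQ : ∀ k, j ≤ k → k < m → Q (k + 1) - Q k ≤ δ) : Q m - Q j ≤ (m - j) * δ := by
  induction m, hjm using Nat.le_induction with
  | base => simp
  | succ m hjm ih =>
    have h1 := ih fun k h1 h2 => hQ k h1 (by omega)
    have h2 := hQ m hjm (by omega)
    push_cast
    linarith

theorem norm_sub_le_of_forall_norm_succ_sub_le {Q : ℕ → E} {δ : ℝ} {j m : ℕ} (hjm : j ≤ m)
    (hQ : ∀ k, j ≤ k → k < m → ‖Q (k + 1) - Q k‖ ≤ δ) : ‖Q m - Q j‖ ≤ (m - j) * δ := by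
  induction m, hjm using Nat.le_induction with
  | base => simp
  | succ m hjm ih =>
    have h1 := ih fun k h1 h2 => hQ k h1 (by omega)
    have h2 := hQ m hjm (by omega)
    have h3 := norm_sub_le_norm_sub_add_norm_sub (Q (m + 1)) (Q m) (Q j)
    push_cast
    linarith

/-- Passage to the limit in one-sided estimates of the increments of a functional. -/
theorem IsMesh.limit_sub_le (hm : IsMesh t T h N) {a b : ℝ} (ha : t ≤ a) (hab : a ≤ b)
    {Q : ℕ → ℕ → ℝ} {A : ℕ → ℝ} {Qa Qb A₀ B : ℝ}
    (hQ : ∀ i k, meshIndex t T (N i) a ≤ k → k < meshIndex t T (N i) b →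
      Q i (k + 1) - Q i k ≤ h i * (A i + B * (h i *
        ((meshIndex t T (N i) b : ℝ) - meshIndex t T (N i) a))))
    (hQa : Tendsto (fun i => Q i (meshIndex t T (N i) a)) (hyperfilter ℕ) (𝓝 Qa))
    (hQb : Tendsto (fun i => Q i (meshIndex t T (N i) b)) (hyperfilter ℕ) (𝓝 Qb))
    (hA : Tendsto A (hyperfilter ℕ) (𝓝 A₀)) :
    Qb - Qa ≤ (b - a) * (A₀ + B * (b - a)) := by
  have hd := hm.tendsto_meshIndex_sub ha (ha.trans hab)
  refine le_of_tendsto_of_tendsto' (hQb.sub hQa) (hd.mul (hA.add (hd.const_mul B))) fun i => ?_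
  refine (sub_le_of_forall_succ_sub_le (meshIndex_mono hm.lt _ hab) (hQ i)).trans_eq ?_
  ring

theorem IsMeshLimit.norm_sub_le (hm : IsMesh t T h N) (hy : IsMeshLimit t T N z y) {K : ℝ}
    (hz : ∀ i, ∀ k < N i, ‖z i (k + 1) - z i k‖ ≤ h i * K) {a b : ℝ} (ha : t ≤ a) (hab : a ≤ b)
    (hb : b ≤ T) : ‖y b - y a‖ ≤ K * (b - a) := by
  have hd := (hm.tendsto_meshIndex_sub ha (ha.trans hab)).const_mul K
  refine le_of_tendsto_of_tendsto'
    ((hy b ⟨ha.trans hab, hb⟩).sub (hy a ⟨ha, hab.trans hb⟩)).norm hd fun i => ?_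
  refine (norm_sub_le_of_forall_norm_succ_sub_le (meshIndex_mono hm.lt _ hab) fun k _ hk =>
    hz i k (hk.trans_le (meshIndex_le hm.lt _ hb))).trans_eq ?_
  ring

theorem IsEuler.norm_succ_sub_le {R L c M : ℝ} (hB : LocalBounds F R L c M) {h : ℝ} {N : ℕ}
    {z : ℕ → E} (hh : 0 ≤ h) (hz : IsEuler F h N z) (hzR : ∀ k ≤ N, ‖z k‖ ≤ R) {k : ℕ}
    (hk : k < N) : ‖z (k + 1) - z k‖ ≤ h * M := by
  obtain ⟨v, hv, e⟩ := hz k hk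
  rw [e, add_sub_cancel_left, norm_smul, Real.norm_of_nonneg hh]
  gcongr
  exact hB.norm_le (hzR k hk.le) v hv

/-- Between two nodes a sequence with increments at most `h * K` moves by at most `K` times the
elapsed time. -/
theorem norm_sub_le_mesh {Q : ℕ → E} {h K : ℝ} (hh : 0 ≤ h) (hK : 0 ≤ K) {j k m : ℕ} (hjk : j ≤ k)
    (hkm : k ≤ m) (hQ : ∀ k < m, ‖Q (k + 1) - Q k‖ ≤ h * K) :
    ‖Q k - Q j‖ ≤ K * (h * ((m : ℝ) - j)) := by
  refine (norm_sub_le_of_forall_norm_succ_sub_le hjk fun i _ hi => hQ i (by omega)).trans ?_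
  have : (k : ℝ) ≤ m := by exact_mod_cast hkm
  calc ((k : ℝ) - j) * (h * K) ≤ ((m : ℝ) - j) * (h * K) := by gcongr
    _ = _ := by ring

theorem IsMeshLimit.intTraj (hF : ∀ x, (F x).Nonempty ∧ Convex ℝ (F x) ∧ IsCompact (F x))
    {R L c M : ℝ} (hB : LocalBounds F R L c M) (hm : IsMesh t T h N)
    (hy : IsMeshLimit t T N z y) (hz : ∀ i, IsEuler F (h i) (N i) (z i))
    (hzR : ∀ i, ∀ k ≤ N i, ‖z i k‖ ≤ R) : IntTraj F t T (L * M) y := by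
  intro a b ha hab hb w
  have hL := hB.L_nonneg
  have haT : a ∈ Icc t T := ⟨ha, hab.trans hb⟩
  have key := hm.limit_sub_le ha hab (Q := fun i k => ⟪z i k, w⟫)
    (A := fun i => Ham F (z i (meshIndex t T (N i) a)) w) (B := L * M * ‖w‖)
    (fun i k hak hkb => by
      have hkN : k < N i := hkb.trans_le (meshIndex_le hm.lt _ hb)
      obtain ⟨v, hv, e⟩ := hz i k hkN
      rw [← inner_sub_left, e, add_sub_cancel_left, real_inner_smul_left]
      refine mul_le_mul_of_nonneg_left ?_ (hm.pos i).le
      have h1 := inner_le_ham (q := w) (hF _).2.2 hv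
      have h2 := hB.ham_lip (hzR i k hkN.le) (hzR i _ (hak.trans hkN.le)) w
      have h3 := norm_sub_le_mesh (hm.pos i).le hB.M_nonneg hak hkb.le fun j hj =>
        (hz i).norm_succ_sub_le hB (hm.pos i).le (hzR i)
          (hj.trans_le (meshIndex_le hm.lt _ hb))
      have h4 := mul_le_mul_of_nonneg_left h3 (mul_nonneg hL (norm_nonneg w))
      linarith)
    ((hy a haT).inner tendsto_const_nhds)
    ((hy b ⟨ha.trans hab, hb⟩).inner tendsto_const_nhds)
    (tendsto_ham hF hB (hy a haT) tendsto_const_nhds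
      (Eventually.of_forall fun i => hzR i _ (meshIndex_le hm.lt _ haT.2))
      (hy.norm_le hm.lt hzR haT))
  rw [inner_sub_left]
  linarith

theorem exists_isTraj_of_isEuler [FiniteDimensional ℝ E]
    (hF : ∀ x, (F x).Nonempty ∧ Convex ℝ (F x) ∧ IsCompact (F x))
    {R L c M : ℝ} (hB : LocalBounds F R L c M) (hm : IsMesh t T h N)
    (hz : ∀ i, IsEuler F (h i) (N i) (z i)) (hzR : ∀ i, ∀ k ≤ N i, ‖z i k‖ ≤ R) :
    ∃ y y' : ℝ → E, IsTraj F t T y y' ∧ Tendsto (fun i => z i 0) (hyperfilter ℕ) (𝓝 (y t)) ∧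
      Tendsto (fun i => z i (N i)) (hyperfilter ℕ) (𝓝 (y T)) := by
  obtain ⟨y, hy⟩ := exists_isMeshLimit (N := N) (z := z) hm.lt hzR
  refine ⟨y, deriv y, ?_, hy.left hm.lt.le, hy.right hm.lt⟩
  exact (hy.intTraj hF hB hm hz hzR).isTraj hF hm.lt.le hB.M_nonneg fun a b ha hab hb =>
    hy.norm_sub_le hm (fun i k hk => (hz i).norm_succ_sub_le hB (hm.pos i).le (hzR i) hk) ha hab hb

end MeshLimit

section HamiltonianLimit

variable {F : E → Set E} {t T : ℝ} {h : ℕ → ℝ} {N : ℕ → ℕ} {z p : ℕ → ℕ → E} {y q : ℝ → E}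

theorem IsExtremal.isEuler {h : ℝ} {N : ℕ} {R c : ℝ} {z p : ℕ → E}
    (hp : IsExtremal F h N R c z p) : IsEuler F h N z := fun k hk => by
  obtain ⟨v, hv, e, -⟩ := hp.velocity k hk
  exact ⟨v, hv, e⟩

theorem IsExtremal.norm_adjoint_succ_sub_le {R L c M P h : ℝ} {N : ℕ} {z p : ℕ → E}
    (hB : LocalBounds F R L c M) (hh : 0 ≤ h) (hE : IsExtremal F h N R c z p)
    (hzR : ∀ k ≤ N, ‖z k‖ + 1 < R) (hpP : ∀ k ≤ N, ‖p k‖ ≤ P) {k : ℕ} (hk : k < N) :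
    ‖p (k + 1) - p k‖ ≤ h * ((L + c) * P) := by
  have hLc : 0 ≤ L + c := add_nonneg hB.L_nonneg hB.c_nonneg
  rw [norm_sub_rev]
  refine (hE.norm_adjoint_sub_le hB hh hzR hk).trans ?_
  gcongr
  exact hpP _ hk

/-- The limit of the discrete maximality condition. -/
theorem IsMeshLimit.inner_ge (hF : ∀ x, (F x).Nonempty ∧ Convex ℝ (F x) ∧ IsCompact (F x))
    {R L c M P : ℝ} (hB : LocalBounds F R L c M) (hm : IsMesh t T h N)
    (hy : IsMeshLimit t T N z y) (hq : IsMeshLimit t T N p q)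
    (hE : ∀ i, IsExtremal F (h i) (N i) R c (z i) (p i))
    (hzR : ∀ i, ∀ k ≤ N i, ‖z i k‖ + 1 < R) (hpP : ∀ i, ∀ k ≤ N i, ‖p i k‖ ≤ P) {a b : ℝ}
    (ha : t ≤ a) (hab : a ≤ b) (hb : b ≤ T) :
    -⟪y b, q a⟫ - -⟪y a, q a⟫ ≤
      (b - a) * (-Ham F (y a) (q a) + (L * M * P + 2 * M * ((L + c) * P)) * (b - a)) := by
  have hL := hB.L_nonneg
  have hc := hB.c_nonneg
  have hM := hB.M_nonneg
  have hP : 0 ≤ P := (norm_nonneg _).trans (hpP 0 0 (Nat.zero_le _))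
  have hzR' : ∀ i, ∀ k ≤ N i, ‖z i k‖ ≤ R := fun i k hk => by linarith [hzR i k hk]
  have haT : a ∈ Icc t T := ⟨ha, hab.trans hb⟩
  refine hm.limit_sub_le ha hab
    (Q := fun i k => -⟪z i k, p i (meshIndex t T (N i) a)⟫)
    (A := fun i => -Ham F (z i (meshIndex t T (N i) a)) (p i (meshIndex t T (N i) a)))
    (fun i k hak hkb => ?_)
    ((hy a haT).inner (hq a haT)).neg ((hy b ⟨ha.trans hab, hb⟩).inner (hq a haT)).neg
    (tendsto_ham hF hB (hy a haT) (hq a haT)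
      (Eventually.of_forall fun i => hzR' i _ (meshIndex_le hm.lt _ haT.2))
      (hy.norm_le hm.lt hzR' haT)).neg
  have hkN : k < N i := hkb.trans_le (meshIndex_le hm.lt _ hb)
  have hbN : ∀ j, j < meshIndex t T (N i) b → j < N i :=
    fun j hj => hj.trans_le (meshIndex_le hm.lt _ hb)
  have hz3 := norm_sub_le_mesh (hm.pos i).le hM hak hkb.le fun j hj =>
    (hE i).isEuler.norm_succ_sub_le hB (hm.pos i).le (hzR' i) (hbN j hj)
  have hp3 := norm_sub_le_mesh (hm.pos i).le (by positivity) (Nat.le_succ_of_le hak) hkb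
    fun j hj => (hE i).norm_adjoint_succ_sub_le hB (hm.pos i).le (hzR i) (hpP i) (hbN j hj)
  obtain ⟨v, hv, e, he⟩ := (hE i).velocity k hkN
  set j := meshIndex t T (N i) a
  set Δ := h i * ((meshIndex t T (N i) b : ℝ) - j)
  rw [neg_sub_neg, ← inner_sub_left, e, sub_add_cancel_left, inner_neg_left, real_inner_smul_left,
    ← mul_neg]
  refine mul_le_mul_of_nonneg_left ?_ (hm.pos i).le
  have h1 : ⟪v, p i (k + 1)⟫ ≤ ⟪v, p i j⟫ + M * ‖p i (k + 1) - p i j‖ := by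
    rw [← sub_le_iff_le_add', ← inner_sub_right]
    exact (real_inner_le_norm _ _).trans
      (mul_le_mul_of_nonneg_right (hB.norm_le (hzR' i k hkN.le) v hv) (norm_nonneg _))
  have h2 := hB.ham_lip (hzR' i j (hak.trans hkN.le)) (hzR' i k hkN.le) (p i (k + 1))
  have h4 := ham_sub_le (hF (z i j)).1 (hF (z i j)).2.2
    (hB.norm_le (hzR' i j (hak.trans hkN.le))) (p i j) (p i (k + 1))
  rw [norm_sub_rev] at h2 h4
  have h5 : L * ‖z i k - z i j‖ * ‖p i (k + 1)‖ ≤ L * (M * Δ) * P := by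
    gcongr
    · exact mul_nonneg hL ((norm_nonneg _).trans hz3)
    · exact hpP i _ hkN
  have h6 := mul_le_mul_of_nonneg_left hp3 hM
  linarith

/-- The limit of the discrete adjoint inclusion. -/
theorem IsMeshLimit.adjoint_le (hF : ∀ x, (F x).Nonempty ∧ Convex ℝ (F x) ∧ IsCompact (F x))
    {R L c M P : ℝ} (hB : LocalBounds F R L c M) (hm : IsMesh t T h N)
    (hy : IsMeshLimit t T N z y) (hq : IsMeshLimit t T N p q)
    (hE : ∀ i, IsExtremal F (h i) (N i) R c (z i) (p i))
    (hzR : ∀ i, ∀ k ≤ N i, ‖z i k‖ + 1 < R) (hpP : ∀ i, ∀ k ≤ N i, ‖p i k‖ ≤ P) {w : E}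
    (hw : ‖w‖ < R) {a b : ℝ} (ha : t ≤ a) (hab : a ≤ b) (hb : b ≤ T) :
    -⟪q b, w - y a⟫ - -⟪q a, w - y a⟫ ≤
      (b - a) * (Ham F w (q a) - Ham F (y a) (q a) + c * P * ‖w - y a‖ ^ 2 +
        ((L + c) * P * M + 2 * M * ((L + c) * P) + L * M * P + c * P * (4 * R * M)) * (b - a)) := by
  have hL := hB.L_nonneg
  have hc := hB.c_nonneg
  have hM := hB.M_nonneg
  have hP : 0 ≤ P := (norm_nonneg _).trans (hpP 0 0 (Nat.zero_le _))
  have hR : 0 ≤ R := (norm_nonneg _).trans hw.le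
  have hzR' : ∀ i, ∀ k ≤ N i, ‖z i k‖ ≤ R := fun i k hk => by linarith [hzR i k hk]
  have haT : a ∈ Icc t T := ⟨ha, hab.trans hb⟩
  have hA : Tendsto (fun i => Ham F w (p i (meshIndex t T (N i) a)) -
      Ham F (z i (meshIndex t T (N i) a)) (p i (meshIndex t T (N i) a)) +
      c * P * ‖w - z i (meshIndex t T (N i) a)‖ ^ 2) (hyperfilter ℕ)
      (𝓝 (Ham F w (q a) - Ham F (y a) (q a) + c * P * ‖w - y a‖ ^ 2)) := by
    refine Tendsto.add (Tendsto.sub ?_ ?_) ((((hy a haT).const_sub w).norm.pow 2).const_mul _)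
    · exact tendsto_ham hF hB tendsto_const_nhds (hq a haT)
        (Eventually.of_forall fun _ => hw.le) hw.le
    · exact tendsto_ham hF hB (hy a haT) (hq a haT)
        (Eventually.of_forall fun i => hzR' i _ (meshIndex_le hm.lt _ haT.2))
        (hy.norm_le hm.lt hzR' haT)
  refine hm.limit_sub_le ha hab
    (Q := fun i k => -⟪p i k, w - z i (meshIndex t T (N i) a)⟫) (fun i k hak hkb => ?_)
    ((hq a haT).inner ((hy a haT).const_sub w)).neg
    ((hq b ⟨ha.trans hab, hb⟩).inner ((hy a haT).const_sub w)).neg hA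
  have hkN : k < N i := hkb.trans_le (meshIndex_le hm.lt _ hb)
  have hbN : ∀ j, j < meshIndex t T (N i) b → j < N i :=
    fun j hj => hj.trans_le (meshIndex_le hm.lt _ hb)
  have hz3 := norm_sub_le_mesh (hm.pos i).le hM hak hkb.le fun j hj =>
    (hE i).isEuler.norm_succ_sub_le hB (hm.pos i).le (hzR' i) (hbN j hj)
  have hp3 := norm_sub_le_mesh (hm.pos i).le (by positivity) (Nat.le_succ_of_le hak) hkb
    fun j hj => (hE i).norm_adjoint_succ_sub_le hB (hm.pos i).le (hzR i) (hpP i) (hbN j hj)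
  obtain ⟨ζ, e, hζ⟩ := (hE i).adjoint k hkN
  have hζn : ‖ζ‖ ≤ (L + c) * P := (hB.norm_subgradient_le (hzR i k hkN.le) hζ).trans
    (mul_le_mul_of_nonneg_left (hpP i _ hkN) (add_nonneg hL hc))
  have hzj := hzR' i _ (hak.trans hkN.le)
  have hzk := hzR' i k hkN.le
  have hpk := hpP i _ hkN
  set j := meshIndex t T (N i) a
  set Δ := h i * ((meshIndex t T (N i) b : ℝ) - j)
  rw [neg_sub_neg, ← inner_sub_left, e, add_sub_cancel_left, real_inner_smul_left]
  refine mul_le_mul_of_nonneg_left ?_ (hm.pos i).le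
  have h0 := hζ w hw
  have h1 : ⟪ζ, w - z i j⟫ ≤ ⟪ζ, w - z i k⟫ + (L + c) * P * (M * Δ) := by
    have : w - z i j = (w - z i k) + (z i k - z i j) := by abel
    rw [this, inner_add_right]
    gcongr
    exact (real_inner_le_norm _ _).trans (mul_le_mul hζn hz3 (norm_nonneg _) (by positivity))
  have h2 := hB.ham_lip hzj hzk (p i (k + 1))
  have h3 := ham_sub_le (hF w).1 (hF w).2.2 (hB.norm_le hw.le) (p i (k + 1)) (p i j)
  have h4 := ham_sub_le (hF (z i j)).1 (hF (z i j)).2.2 (hB.norm_le hzj) (p i j) (p i (k + 1))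
  rw [norm_sub_rev] at h2 h4
  have h5 : L * ‖z i k - z i j‖ * ‖p i (k + 1)‖ ≤ L * (M * Δ) * P := by
    gcongr
    exact mul_nonneg hL ((norm_nonneg _).trans hz3)
  have h6 := mul_le_mul_of_nonneg_left hp3 hM
  have h7 : ‖w - z i k‖ ^ 2 ≤ ‖w - z i j‖ ^ 2 + 4 * R * (M * Δ) := by
    have e1 : ‖w - z i k‖ ≤ ‖w - z i j‖ + ‖z i k - z i j‖ := by
      have : w - z i k = (w - z i j) - (z i k - z i j) := by abel
      rw [this]
      exact _root_.norm_sub_le _ _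
    have e2 : ‖w - z i k‖ ≤ 2 * R := (_root_.norm_sub_le _ _).trans (by linarith)
    have e3 : ‖w - z i j‖ ≤ 2 * R := (_root_.norm_sub_le _ _).trans (by linarith)
    have e4 := norm_nonneg (w - z i k)
    have e5 := norm_nonneg (w - z i j)
    calc ‖w - z i k‖ ^ 2
        = ‖w - z i j‖ ^ 2 + (‖w - z i k‖ + ‖w - z i j‖) * (‖w - z i k‖ - ‖w - z i j‖) := by ring
      _ ≤ ‖w - z i j‖ ^ 2 + (‖w - z i k‖ + ‖w - z i j‖) * (M * Δ) := by
        gcongr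
        linarith
      _ ≤ _ := by
        have := (norm_nonneg _).trans hz3
        gcongr
        linarith
  have h8 : c * ‖p i (k + 1)‖ * ‖w - z i k‖ ^ 2 ≤
      c * P * (‖w - z i j‖ ^ 2 + 4 * R * (M * Δ)) := by gcongr
  linarith

theorem gradpH_eq_of_hasDerivAt (hF : ∀ x, (F x).Nonempty ∧ Convex ℝ (F x) ∧ IsCompact (F x))
    (hH1 : HypH1 F) {C B : ℝ} (hy : IntTraj F t T C y) {a : ℝ} (ha : a ∈ Ico t T) {v w : E}
    (hv : HasDerivAt y v a) (hw : w ≠ 0)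
    (h : ∀ b, a < b → b ≤ T → -⟪y b, w⟫ - -⟪y a, w⟫ ≤
      (b - a) * (-Ham F (y a) w + B * (b - a))) : v = gradpH F (y a) w := by
  have hmem := hy.mem_of_hasDerivAt hF ha hv
  refine eq_of_hasGradientAt_ham (hF _).2.2 (hH1.2.1 _ w hw) hmem ?_
  refine le_antisymm (inner_le_ham (hF _).2.2 hmem) ?_
  have h1 : HasDerivAt (fun s => -⟪y s, w⟫) (-⟪v, w⟫) a := by
    simp_rw [fun s => real_inner_comm w (y s), real_inner_comm w v]
    exact ((innerSL ℝ w).hasFDerivAt.comp_hasDerivAt a hv).neg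
  have := deriv_le_of_quadratic h1 ha.2 h
  linarith

/-- A curve whose derivative agrees almost everywhere with a continuous function can be modified
outside `[t, T]` so that it is differentiable at every point of `[t, T]`. -/
theorem exists_hasDerivAt_extension {y y' G : ℝ → E} (hy : ACArc t T y y') (hG : Continuous G)
    (hGy : ∀ᵐ s ∂(volume : Measure ℝ), s ∈ Icc t T → y' s = G s) :
    ∃ Y : ℝ → E, (∀ s ∈ Icc t T, Y s = y s) ∧ (∀ s, HasDerivAt Y (G s) s) ∧ ACArc t T Y G := by
  set Y : ℝ → E := fun s => y t + ∫ r in t..s, G r with hY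
  have hYd : ∀ s, HasDerivAt Y (G s) s := fun s =>
    (hG.integral_hasStrictDerivAt t s).hasDerivAt.const_add _
  refine ⟨Y, fun s hs => ?_, hYd, hG.intervalIntegrable _ _, fun s _ => by simp [hY],
    Eventually.of_forall fun s _ => hYd s⟩
  change y t + ∫ r in t..s, G r = _
  rw [hy.2.1 s hs]
  congr 1
  refine intervalIntegral.integral_congr_ae ?_
  filter_upwards [hGy] with r hr hmem
  rw [uIoc_of_le hs.1] at hmem
  exact (hr ⟨hmem.1.le, hmem.2.trans hs.2⟩).symm

/-- Discrete extremals converge to solutions of the Hamiltonian system. -/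
theorem exists_hamiltonian_limit [FiniteDimensional ℝ E]
    (hF : ∀ x, (F x).Nonempty ∧ Convex ℝ (F x) ∧ IsCompact (F x)) (hH1 : HypH1 F)
    {R R' L c M P m : ℝ} (hB : LocalBounds F R L c M) (hm : IsMesh t T h N)
    (hE : ∀ i, IsExtremal F (h i) (N i) R c (z i) (p i)) (hR' : R' + 1 < R)
    (hzR' : ∀ i, ∀ k ≤ N i, ‖z i k‖ ≤ R') (hpP : ∀ i, ∀ k ≤ N i, ‖p i k‖ ≤ P)
    (hm0 : 0 < m) (hpm : ∀ i, ∀ k ≤ N i, m ≤ ‖p i k‖) :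
    ∃ Y q q' : ℝ → E,
      (∀ s ∈ Icc t T, HasDerivAt Y (gradpH F (Y s) (q s)) s) ∧ ACArc t T q q' ∧
      (∀ᵐ s ∂volume, s ∈ Icc t T → -q' s ∈ FSub (fun z => Ham F z (q s)) (Y s)) ∧
      IsTraj F t T Y (fun s => gradpH F (Y s) (q s)) ∧
      Tendsto (fun i => z i 0) (hyperfilter ℕ) (𝓝 (Y t)) ∧
      Tendsto (fun i => z i (N i)) (hyperfilter ℕ) (𝓝 (Y T)) ∧
      Tendsto (fun i => p i 0) (hyperfilter ℕ) (𝓝 (q t)) := by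
  have htT := hm.lt.le
  have hLc : 0 ≤ L + c := add_nonneg hB.L_nonneg hB.c_nonneg
  have hP : 0 ≤ P := (norm_nonneg _).trans (hpP 0 0 (Nat.zero_le _))
  have hzR : ∀ i, ∀ k ≤ N i, ‖z i k‖ + 1 < R := fun i k hk => by linarith [hzR' i k hk]
  have hzR2 : ∀ i, ∀ k ≤ N i, ‖z i k‖ ≤ R := fun i k hk => by linarith [hzR' i k hk]
  obtain ⟨y, hy⟩ := exists_isMeshLimit (N := N) (z := z) hm.lt hzR'
  obtain ⟨q, hq⟩ := exists_isMeshLimit (N := N) (z := p) hm.lt hpP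
  have hyR : ∀ s ∈ Icc t T, ‖y s‖ < R := fun s hs => by
    linarith [hy.norm_le hm.lt hzR' hs]
  have hq0 : ∀ s ∈ Icc t T, q s ≠ 0 := fun s hs => by
    have : m ≤ ‖q s‖ := ge_of_tendsto (hq s hs).norm
      (Eventually.of_forall fun i => hpm i _ (meshIndex_le hm.lt _ hs.2))
    exact norm_pos_iff.1 (hm0.trans_le this)
  have hyI := hy.intTraj hF hB hm (fun i => (hE i).isEuler) hzR2
  have hyM : ∀ a b, t ≤ a → a ≤ b → b ≤ T → ‖y b - y a‖ ≤ M * (b - a) := fun a b ha hab hb =>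
    hy.norm_sub_le hm
      (fun i k hk => (hE i).isEuler.norm_succ_sub_le hB (hm.pos i).le (hzR2 i) hk) ha hab hb
  have hqM : ∀ a b, t ≤ a → a ≤ b → b ≤ T → ‖q b - q a‖ ≤ ((L + c) * P) * (b - a) :=
    fun a b ha hab hb => hq.norm_sub_le hm
      (fun i k hk => (hE i).norm_adjoint_succ_sub_le hB (hm.pos i).le (hzR i) (hpP i) hk) ha hab hb
  have hyac := acArc_deriv_of_lipschitz htT hB.M_nonneg hyM
  have hqac := acArc_deriv_of_lipschitz htT (by positivity) hqM
  have hproj : ∀ {u : ℝ → E}, ACArc t T u (deriv u) →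
      Continuous fun s => u (projIcc t T htT s) := fun hu =>
    (continuousOn_iff_continuous_domRestrict.1 (acArc_continuousOn hu htT)).comp
      (continuous_projIcc (h := htT))
  set G : ℝ → E := fun s => gradpH F (y (projIcc t T htT s)) (q (projIcc t T htT s)) with hGdef
  have hG : Continuous G := continuous_iff_continuousAt.2 fun s =>
    tendsto_gradpH hF hH1 hB ((hproj hyac).tendsto s) ((hproj hqac).tendsto s)
      (Eventually.of_forall fun r => (hyR _ (projIcc t T htT r).2).le)
      (hyR _ (projIcc t T htT s).2).le (hq0 _ (projIcc t T htT s).2)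
  have hGeq : ∀ s ∈ Icc t T, G s = gradpH F (y s) (q s) := fun s hs => by
    simp only [hGdef, projIcc_of_mem htT hs]
  have hsT : ∀ᵐ s ∂(volume : Measure ℝ), s ≠ T := by simp [ae_iff]
  obtain ⟨Y, hYy, hYd, hYac⟩ := exists_hasDerivAt_extension hyac hG (by
    filter_upwards [hyac.2.2, hsT] with s hs hne hmem
    rw [hGeq s hmem]
    exact gradpH_eq_of_hasDerivAt hF hH1 hyI ⟨hmem.1, lt_of_le_of_ne hmem.2 hne⟩ (hs hmem)
      (hq0 s hmem) fun b hab hb => hy.inner_ge hF hB hm hq hE hzR hpP hmem.1 hab.le hb)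
  have hGY : ∀ s ∈ Icc t T, G s = gradpH F (Y s) (q s) := fun s hs => by
    rw [hGeq s hs, hYy s hs]
  refine ⟨Y, q, deriv q, fun s hs => hGY s hs ▸ hYd s, hqac, ?_, ⟨⟨?_, fun s hs => ?_, ?_⟩, ?_⟩,
    ?_, ?_, hq.left htT⟩
  · filter_upwards [hqac.2.2, hsT] with s hs hne hmem
    rw [hYy s hmem]
    refine mem_fsub_of_quadratic (k := c * P) (hyR s hmem) fun w hw => ?_
    have h1 : HasDerivAt (fun r => -⟪q r, w - y s⟫) (-⟪deriv q s, w - y s⟫) s := by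
      simp_rw [fun r => real_inner_comm (w - y s) (q r), real_inner_comm (w - y s) (deriv q s)]
      exact ((innerSL ℝ (w - y s)).hasFDerivAt.comp_hasDerivAt s (hs hmem)).neg
    have h2 := deriv_le_of_quadratic h1 (lt_of_le_of_ne hmem.2 hne) fun b hab hb =>
      hy.adjoint_le hF hB hm hq hE hzR hpP hw hmem.1 hab.le hb
    rw [inner_neg_left]
    linarith
  · refine hYac.1.congr fun s hs => ?_
    rw [uIoc_of_le htT] at hs
    exact hGY s ⟨hs.1.le, hs.2⟩
  · rw [hYac.2.1 s hs]
    congr 1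
    refine intervalIntegral.integral_congr fun r hr => ?_
    rw [uIcc_of_le hs.1] at hr
    exact hGY r ⟨hr.1, hr.2.trans hs.2⟩
  · exact Eventually.of_forall fun s hs => (hGY s hs).subst (motive := fun v => HasDerivAt Y v s) (hYd s)
  · exact Eventually.of_forall fun s hs =>
      (gradpH_mem (hF _).1 (hF _).2.2 (hH1.2.1 _ _ (hq0 s hs))).1
  · rw [hYy t ⟨le_rfl, htT⟩]
    exact hy.left htT
  · rw [hYy T ⟨htT, le_rfl⟩]
    exact hy.right hm.lt

end HamiltonianLimit

section ValueFunction

variable {F : E → Set E} {φ : E → ℝ} {t T τ r R : ℝ} {ξ : E} {y y' : ℝ → E}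

theorem IsEuler.norm_le_exp {h ℓ : ℝ} {N : ℕ} {z : ℕ → E} (hz : IsEuler F h N z) (hh : 0 ≤ h)
    (hr : 0 < r) (hgrow : ∀ x : E, ∀ v ∈ F x, ‖v‖ ≤ r * (1 + ‖x‖)) (hhN : h * N ≤ ℓ) :
    ∀ k ≤ N, ‖z k‖ ≤ Real.exp (r * ℓ) * (1 + ‖z 0‖) := by
  intro k hk
  have h1 := hz.norm_le hh hgrow k hk
  have h2 : r * h * k ≤ r * ℓ := by
    rw [mul_assoc]
    have : h * k ≤ h * N := by gcongr
    exact mul_le_mul_of_nonneg_left (this.trans hhN) hr.le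
  have h3 : Real.exp (r * h * k) * (1 + ‖z 0‖) ≤ Real.exp (r * ℓ) * (1 + ‖z 0‖) := by gcongr
  linarith

theorem isTraj_norm_le_exp (h : IsTraj F t T y y') (htT : t ≤ T) (hr : 0 < r)
    (hgrow : ∀ x : E, ∀ v ∈ F x, ‖v‖ ≤ r * (1 + ‖x‖))
    (hR : Real.exp (r * (T - t)) * (1 + ‖y t‖) ≤ R) {s : ℝ} (hs : s ∈ Icc t T) : ‖y s‖ ≤ R := by
  have h1 := isTraj_norm_le h htT hr hgrow hs
  have h2 : (1 + ‖y t‖) * Real.exp (r * (s - t)) ≤ (1 + ‖y t‖) * Real.exp (r * (T - t)) := by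
    gcongr
    exact hs.2
  linarith

/-- Every trajectory is a limit of Euler polygons with prescribed, convergent, initial points. -/
theorem exists_isEuler_tendsto (hF : ∀ x, (F x).Nonempty ∧ Convex ℝ (F x) ∧ IsCompact (F x))
    {L c M : ℝ} (hB : LocalBounds F R L c M) {h : ℕ → ℝ} {N : ℕ → ℕ} (hm : IsMesh t T h N)
    (hN : ∀ i, 0 < N i) (hy : IsTraj F t T y y') (hyR : ∀ s ∈ Icc t T, ‖y s‖ ≤ R) {w : ℕ → E}
    (hw : Tendsto w (hyperfilter ℕ) (𝓝 (y t)))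
    (hwR : ∀ i z, IsEuler F (h i) (N i) z → z 0 = w i → ∀ k ≤ N i, ‖z k‖ ≤ R) :
    ∃ ζ : ℕ → ℕ → E, (∀ i, IsEuler F (h i) (N i) (ζ i)) ∧ (∀ i, ζ i 0 = w i) ∧
      Tendsto (fun i => ζ i (N i)) (hyperfilter ℕ) (𝓝 (y T)) := by
  have key := fun i => exists_isEuler_near hF hB hm.lt.le (mul_nonneg hB.L_nonneg hB.M_nonneg)
    (isTraj_intTraj hF hB hy hyR) hyR
    (fun a b ha hab hb => isTraj_norm_sub_le hB hy hyR ha hab hb) (hN i) (hm.pos i).le (hwR i)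
  choose ζ hζ hζ0 hζN using key
  refine ⟨ζ, hζ, hζ0, ?_⟩
  rw [tendsto_iff_norm_sub_tendsto_zero]
  have h1 : Tendsto (fun i => Real.exp (L * (h i * N i)) * (‖w i - y t‖ +
      (h i * (L * M * (T - t)) + |h i * N i - (T - t)| * M))) (hyperfilter ℕ)
      (𝓝 (Real.exp (L * (T - t)) * (0 + (0 * (L * M * (T - t)) + |T - t - (T - t)| * M)))) := by
    have e1 := hm.tendsto_zero.mono_left Nat.hyperfilter_le_atTop
    have e2 := hm.tendsto_mul.mono_left Nat.hyperfilter_le_atTop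
    exact ((Real.continuous_exp.tendsto _).comp (e2.const_mul L)).mul
      ((tendsto_iff_norm_sub_tendsto_zero.1 hw).add
        ((e1.mul_const _).add (((e2.sub_const _).abs).mul_const M)))
  rw [sub_self, abs_zero, zero_mul, zero_mul, add_zero, add_zero, mul_zero] at h1
  refine squeeze_zero (fun _ => norm_nonneg _) (fun i => (hζN i).trans_eq ?_) h1
  have hN' : (0:ℝ) < N i := by exact_mod_cast hN i
  have e3 : |h i * N i - (T - t)| = N i * |h i - (T - t) / N i| := by
    rw [← abs_of_pos hN', ← abs_mul, abs_of_pos hN']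
    congr 1
    field_simp
  rw [e3, mul_assoc L]
  congr 2
  field_simp

theorem isMesh_uniform (hτ : τ < T) :
    IsMesh τ T (fun j => (T - τ) / ((j + 1 : ℕ) : ℝ)) (fun j => j + 1) where
  lt := hτ
  pos j := div_pos (by linarith) (by positivity)
  tendsto_zero := (tendsto_const_div_atTop_nhds_zero_nat (T - τ)).comp (tendsto_add_atTop_nat 1)
  tendsto_mul := by
    refine tendsto_const_nhds.congr fun j => ?_
    have : ((j + 1 : ℕ) : ℝ) ≠ 0 := by positivity
    field_simp

theorem exists_isTraj [FiniteDimensional ℝ E]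
    (hF : ∀ x, (F x).Nonempty ∧ Convex ℝ (F x) ∧ IsCompact (F x)) {L c M : ℝ}
    (hB : LocalBounds F R L c M) (hr : 0 < r)
    (hgrow : ∀ x : E, ∀ v ∈ F x, ‖v‖ ≤ r * (1 + ‖x‖)) (hτ : τ < T)
    (hR : Real.exp (r * (T - τ)) * (1 + ‖ξ‖) ≤ R) :
    ∃ y y' : ℝ → E, IsTraj F τ T y y' ∧ y τ = ξ := by
  have hm := isMesh_uniform hτ
  choose f hf using fun x => (hF x).1
  choose z hz0 _ hz using fun j : ℕ =>
    exists_isEuler_of_selection ((T - τ) / ((j + 1 : ℕ) : ℝ)) ξ (fun _ => f) fun _ => hf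
  obtain ⟨y, y', hy, h0, -⟩ := exists_isTraj_of_isEuler hF hB hm (fun j => hz j (j + 1))
    fun j k hk => ((hz j (j + 1)).norm_le_exp (hm.pos j).le hr hgrow
      (div_mul_cancel₀ (T - τ) (by positivity)).le k hk).trans (by rwa [hz0])
  simp only [hz0] at h0
  exact ⟨y, y', hy, tendsto_nhds_unique tendsto_const_nhds h0 |>.symm⟩

theorem valueFn_le [FiniteDimensional ℝ E] (hφ : Continuous φ) (hr : 0 < r)
    (hgrow : ∀ x : E, ∀ v ∈ F x, ‖v‖ ≤ r * (1 + ‖x‖)) (hτ : τ ≤ T) (hy : IsTraj F τ T y y') :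
    valueFn F φ T τ (y τ) ≤ φ (y T) := by
  obtain ⟨b, hb⟩ := ((isCompact_closedBall (0:E)
    (Real.exp (r * (T - τ)) * (1 + ‖y τ‖))).image hφ).bddBelow
  refine csInf_le ⟨b, ?_⟩ ⟨y, y', hy, rfl, rfl⟩
  rintro _ ⟨z, z', hz, h0, rfl⟩
  refine hb (mem_image_of_mem _ ?_)
  rw [mem_closedBall_zero_iff]
  exact isTraj_norm_le_exp hz hτ hr hgrow (by rw [h0]) ⟨hτ, le_rfl⟩

theorem exists_isTraj_lt_valueFn_add [FiniteDimensional ℝ E]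
    (hF : ∀ x, (F x).Nonempty ∧ Convex ℝ (F x) ∧ IsCompact (F x)) {L c M : ℝ}
    (hB : LocalBounds F R L c M) (hr : 0 < r)
    (hgrow : ∀ x : E, ∀ v ∈ F x, ‖v‖ ≤ r * (1 + ‖x‖)) (hτ : τ < T)
    (hR : Real.exp (r * (T - τ)) * (1 + ‖ξ‖) ≤ R) {ε : ℝ} (hε : 0 < ε) :
    ∃ y y' : ℝ → E, IsTraj F τ T y y' ∧ y τ = ξ ∧ φ (y T) < valueFn F φ T τ ξ + ε := by
  obtain ⟨y, y', hy, h0⟩ := exists_isTraj hF hB hr hgrow hτ hR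
  obtain ⟨_, ⟨y, y', hy, h0, rfl⟩, hlt⟩ := exists_lt_of_csInf_lt
    (s := {r | ∃ y y' : ℝ → E, IsTraj F τ T y y' ∧ y τ = ξ ∧ r = φ (y T)})
    ⟨_, y, y', hy, h0, rfl⟩ (lt_add_of_pos_right _ hε)
  exact ⟨y, y', hy, h0, hlt⟩

theorem hasGradientAt_quadratic (g ξ w : E) (κ : ℝ) :
    HasGradientAt (fun w => κ * ‖w - ξ‖ ^ 2 - ⟪g, w - ξ⟫) ((2 * κ) • (w - ξ) - g) w := by
  rw [hasGradientAt_iff_hasFDerivAt]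
  have h1 : HasFDerivAt (fun w : E => w - ξ) (ContinuousLinearMap.id ℝ E) w :=
    (hasFDerivAt_id w).sub_const ξ
  have h2 := (h1.norm_sq.const_mul κ).sub ((innerSL ℝ g).hasFDerivAt.comp w h1)
  refine h2.congr_fderiv ?_
  ext v
  simp
  ring

/-- Near a point where the value function has spatial gradient `g` there are discrete extremals,
optimal from their initial points, with initial adjoint vector close to `-g`. -/
theorem exists_isExtremal_near [FiniteDimensional ℝ E]
    (hF : ∀ x, (F x).Nonempty ∧ Convex ℝ (F x) ∧ IsCompact (F x)) {L c M : ℝ}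
    (hB : LocalBounds F R L c M) (hr : 0 < r)
    (hgrow : ∀ x : E, ∀ v ∈ F x, ‖v‖ ≤ r * (1 + ‖x‖)) (hφ : ContDiff ℝ 1 φ) (hτ : τ < T)
    (hR : Real.exp (r * (T - τ)) * (1 + (‖ξ‖ + 1)) < R) {g : E}
    (hg : HasGradientAt (valueFn F φ T τ) g ξ) {ε h₀ : ℝ} (hε : 0 < ε) (hε1 : ε ≤ 1)
    (hh₀ : 0 < h₀) :
    ∃ (N : ℕ) (h : ℝ) (z p : ℕ → E), 0 < N ∧ 0 < h ∧ h < h₀ ∧ h * N = T - τ ∧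
      IsExtremal F h N R c z p ∧ p N = -gradient φ (z N) ∧
      (∀ z', IsEuler F h N z' → z' 0 = z 0 → φ (z N) ≤ φ (z' N)) ∧
      ‖z 0 - ξ‖ ≤ ε ∧ ‖p 0 + g‖ ≤ ε := by
  obtain ⟨ρ₀, hρ₀, hV₀⟩ := Metric.eventually_nhds_iff_ball.1
    ((hasGradientAt_iff_isLittleO.1 hg).def (c := ε / 4) (by positivity))
  set ρ := min (ρ₀ / 2) ε with hρdef
  have hρ : 0 < ρ := lt_min (by positivity) hε
  have hρε : ρ ≤ ε := min_le_right _ _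
  have hV : ∀ w ∈ closedBall ξ ρ, valueFn F φ T τ ξ + ⟪g, w - ξ⟫ - ε / 4 * ‖w - ξ‖ ≤
      valueFn F φ T τ w := by
    intro w hw
    have h1 : w ∈ ball ξ ρ₀ := by
      rw [mem_closedBall] at hw
      rw [mem_ball]
      linarith [min_le_left (ρ₀ / 2) ε]
    have := (abs_le.1 (hV₀ w h1)).1
    linarith
  set κ := ε / 2 / ρ with hκ
  have hκρ : κ * ρ = ε / 2 := by rw [hκ]; field_simp
  set ψ : E → ℝ := fun w => κ * ‖w - ξ‖ ^ 2 - ⟪g, w - ξ⟫ with hψ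
  have hψc : Continuous ψ := by fun_prop
  have hψξ : ψ ξ = 0 := by simp [hψ]
  have hm := isMesh_uniform hτ
  set h : ℕ → ℝ := fun j => (T - τ) / ((j + 1 : ℕ) : ℝ) with hh
  have hhN : ∀ j : ℕ, h j * ((j + 1 : ℕ) : ℝ) = T - τ := fun j => by
    have : ((j + 1 : ℕ) : ℝ) ≠ 0 := by positivity
    simp only [hh]
    field_simp
  have hball : ∀ j z, IsEuler F (h j) (j + 1) z → z 0 ∈ closedBall ξ ρ →
      ∀ k ≤ j + 1, ‖z k‖ < R := by
    intro j z hz h0 k hk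
    refine (hz.norm_le_exp (hm.pos j).le hr hgrow (hhN j).le k hk).trans_lt (lt_of_le_of_lt ?_ hR)
    rw [mem_closedBall, dist_eq_norm] at h0
    have h1 := norm_le_norm_add_norm_sub' (z 0) ξ
    gcongr
    linarith
  choose z hz hz0 hzmin using fun j => exists_isEuler_minimizer (N := j + 1) hF hB (hm.pos j)
    (isCompact_closedBall ξ ρ) ⟨ξ, by simp [hρ.le]⟩ (fun z hz h0 k hk => (hball j z hz h0 k hk).le)
    hφ.continuous hψc
  obtain ⟨j, hj, hjρ⟩ : ∃ j, h j < h₀ ∧ ‖z j 0 - ξ‖ < ρ := by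
    by_contra! hcon
    have hev : ∀ᶠ j in (hyperfilter ℕ : Filter ℕ), ρ ≤ ‖z j 0 - ξ‖ :=
      ((hm.tendsto_zero.mono_left Nat.hyperfilter_le_atTop).eventually
        (gt_mem_nhds hh₀)).mono hcon
    obtain ⟨y, y', hy, hy0, hyT⟩ := exists_isTraj_of_isEuler hF hB hm hz
      fun j k hk => (hball j _ (hz j) (hz0 j) k hk).le
    have hyρ : ρ ≤ ‖y τ - ξ‖ := ge_of_tendsto (hy0.sub_const ξ).norm hev
    have hyρ' : y τ ∈ closedBall ξ ρ :=
      isClosed_closedBall.mem_of_tendsto hy0 (Eventually.of_forall hz0)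
    have hξR : Real.exp (r * (T - τ)) * (1 + ‖ξ‖) ≤ R := by
      refine le_trans ?_ hR.le
      gcongr
      linarith
    have hle : φ (y T) + ψ (y τ) ≤ valueFn F φ T τ ξ := by
      refine le_of_forall_pos_le_add fun δ hδ => ?_
      obtain ⟨η, η', hη, hη0, hηT⟩ := exists_isTraj_lt_valueFn_add (φ := φ) hF hB hr hgrow hτ hξR hδ
      obtain ⟨ζ, hζ, hζ0, hζT⟩ := exists_isEuler_tendsto hF hB hm (fun j => Nat.succ_pos j) hη
        (fun s hs => isTraj_norm_le_exp hη hτ.le hr hgrow (by rwa [hη0]) hs)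
        (w := fun _ => ξ) (by rw [hη0]; exact tendsto_const_nhds)
        fun j z hz h0 k hk => (hball j z hz (by simp [h0, hρ.le]) k hk).le
      have h1 : φ (y T) + ψ (y τ) ≤ φ (η T) + ψ ξ := by
        refine le_of_tendsto_of_tendsto'
          (((hφ.continuous.tendsto _).comp hyT).add ((hψc.tendsto _).comp hy0))
          (((hφ.continuous.tendsto _).comp hζT).add tendsto_const_nhds) fun j => ?_
        have := hzmin j (ζ j) (hζ j) (by simp [hζ0, hρ.le])
        simpa [hζ0] using this
      linarith
    have h2 := valueFn_le hφ.continuous hr hgrow hτ.le hy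
    have h3 := hV _ hyρ'
    have h4 : ‖y τ - ξ‖ = ρ := le_antisymm (by rwa [← dist_eq_norm]) hyρ
    simp only [hψ, h4] at hle h3
    have h5 : κ * ρ ^ 2 = ε / 2 * ρ := by rw [pow_two, ← mul_assoc, hκρ]
    have h6 : 0 < ε * ρ := by positivity
    linarith
  have hzR := hball j _ (hz j) (hz0 j)
  have hopt : ∀ z', IsEuler F (h j) (j + 1) z' → z' 0 = z j 0 →
      φ (z j (j + 1)) ≤ φ (z' (j + 1)) := by
    intro z' hz' h0
    have := hzmin j z' hz' (h0 ▸ hz0 j)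
    rw [h0] at this
    linarith
  obtain ⟨p, hpN, hp, hs⟩ := exists_isExtremal hF hB (hm.pos j) (hφ.differentiable (by simp))
    (hz j) hzR hopt
  have hp0 := hs.eq_of_isMin (hasGradientAt_quadratic g ξ (z j 0) κ)
    (ρ := ρ) (by rwa [mem_ball, dist_eq_norm]) (hzmin j)
  refine ⟨j + 1, h j, z j, p, Nat.succ_pos j, hm.pos j, hj, hhN j, hp, hpN, hopt,
    hjρ.le.trans hρε, ?_⟩
  rw [hp0, sub_add_cancel, norm_smul, Real.norm_of_nonneg (by positivity)]
  have := mul_le_mul_of_nonneg_left hjρ.le (show 0 ≤ 2 * κ by positivity)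
  linarith

/-- The dynamic programming principle bounds the time derivative of the value function by its
spatial gradient. -/
theorem abs_fst_le_of_hasGradPair [FiniteDimensional ℝ E]
    (hF : ∀ x, (F x).Nonempty ∧ Convex ℝ (F x) ∧ IsCompact (F x)) {L c M : ℝ}
    (hB : LocalBounds F R L c M) (hr : 0 < r)
    (hgrow : ∀ x : E, ∀ v ∈ F x, ‖v‖ ≤ r * (1 + ‖x‖)) (hφ : Continuous φ) (hτ : τ < T)
    (hR : Real.exp (r * (T - τ)) * (1 + ‖ξ‖) ≤ R) {g : ℝ × E}
    (hg : HasGradPair (valueFn F φ T) τ ξ g) : |g.1| ≤ M * ‖g.2‖ := by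
  have hM := hB.M_nonneg
  have key : ∀ ε > (0:ℝ), |g.1| ≤ M * ‖g.2‖ + ε * (2 + M) := by
    intro ε hε
    obtain ⟨ρ, hρ, hV⟩ := Metric.eventually_nhds_iff_ball.1 (hg.isLittleO.def hε)
    obtain ⟨s, hs0, hs⟩ : ∃ s, 0 < s ∧ s < min (min (T - τ) ε) (ρ / (1 + M)) :=
      exists_between (lt_min (lt_min (by linarith) hε) (by positivity))
    have hsT : s < T - τ := hs.trans_le ((min_le_left _ _).trans (min_le_left _ _))
    have hsε : s < ε := hs.trans_le ((min_le_left _ _).trans (min_le_right _ _))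
    have hsρ : s * (1 + M) < ρ := (lt_div_iff₀ (by positivity)).1 (hs.trans_le (min_le_right _ _))
    obtain ⟨y, y', hy, hy0, hyT⟩ := exists_isTraj_lt_valueFn_add (φ := φ) hF hB hr hgrow hτ hR
      (ε := s ^ 2) (by positivity)
    have hyR : ∀ a ∈ Icc τ T, ‖y a‖ ≤ R := fun a ha =>
      isTraj_norm_le_exp hy hτ.le hr hgrow (by rwa [hy0]) ha
    have hys := isTraj_norm_sub_le hB hy hyR le_rfl (b := τ + s) (by linarith) (by linarith)
    rw [hy0, add_sub_cancel_left] at hys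
    have hup : valueFn F φ T (τ + s) (y (τ + s)) ≤ valueFn F φ T τ ξ + s ^ 2 :=
      (valueFn_le hφ hr hgrow (by linarith)
        (isTraj_mono hy (by linarith) (by linarith))).trans hyT.le
    have hlow : valueFn F φ T τ ξ ≤ valueFn F φ T (τ + s) (y (τ + s)) := by
      refine le_csInf ⟨_, y, y', isTraj_mono hy (by linarith) (by linarith), rfl, rfl⟩ ?_
      rintro _ ⟨z, z', hz, hz0, rfl⟩
      have hyτ := isTraj_norm_le hy hτ.le hr hgrow (s := τ + s) ⟨by linarith, by linarith⟩
      rw [hy0, add_sub_cancel_left] at hyτ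
      have hzR : Real.exp (r * (T - (τ + s))) * (1 + ‖z (τ + s)‖) ≤ R := by
        rw [hz0]
        refine le_trans ?_ hR
        calc Real.exp (r * (T - (τ + s))) * (1 + ‖y (τ + s)‖)
            ≤ Real.exp (r * (T - (τ + s))) * ((1 + ‖ξ‖) * Real.exp (r * s)) := by gcongr
          _ = Real.exp (r * (T - (τ + s)) + r * s) * (1 + ‖ξ‖) := by rw [Real.exp_add]; ring
          _ = Real.exp (r * (T - τ)) * (1 + ‖ξ‖) := by ring_nf
      obtain ⟨w, w', hw, hwτ, hwT⟩ := exists_isTraj_concat hF hB (by linarith) (by linarith)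
        hy hz hz0.symm hyR fun a ha => isTraj_norm_le_exp hz (by linarith) hr hgrow hzR ha
      have := valueFn_le hφ hr hgrow hτ.le hw
      rwa [hwτ, hwT, hy0] at this
    set δ := y (τ + s) - ξ with hδ
    have hnorm : ‖((τ + s, y (τ + s)) - (τ, ξ) : ℝ × E)‖ ≤ s * (1 + M) := by
      rw [Prod.mk_sub_mk, add_sub_cancel_left, ← hδ, Prod.norm_def, Real.norm_of_nonneg hs0.le]
      refine max_le ?_ ?_ <;> nlinarith
    have hlin := hV (τ + s, y (τ + s)) (by
      rw [mem_ball, dist_eq_norm]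
      exact hnorm.trans_lt hsρ)
    replace hlin := hlin.trans (mul_le_mul_of_nonneg_left hnorm hε.le)
    simp only [Prod.mk_sub_mk, add_sub_cancel_left, ← hδ, add_apply,
      smul_apply, ContinuousLinearMap.coe_fst', smul_eq_mul,
      ContinuousLinearMap.comp_apply, ContinuousLinearMap.coe_snd', innerSL_apply_apply,
      Real.norm_eq_abs] at hlin
    have hin : |⟪g.2, δ⟫| ≤ ‖g.2‖ * (M * s) :=
      (abs_real_inner_le_norm _ _).trans (by gcongr)
    obtain ⟨h1, h2⟩ := abs_le.1 hlin
    obtain ⟨h3, h4⟩ := abs_le.1 hin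
    have h5 : s ^ 2 ≤ ε * s := by nlinarith
    refine le_of_mul_le_mul_right ?_ hs0
    rw [← abs_of_pos hs0, ← abs_mul, abs_of_pos hs0]
    exact abs_le.2 ⟨by linarith, by linarith⟩
  refine le_of_forall_pos_le_add fun ε hε => ?_
  have := key (ε / (2 + M)) (by positivity)
  rwa [div_mul_cancel₀ _ (by positivity)] at this

end ValueFunction

section ReachableGradient

variable {F : E → Set E} {φ : E → ℝ} {t T τ r R : ℝ} {x ξ : E}

theorem hasGradientAt_of_hasGradPair {W : ℝ → E → ℝ} {g : ℝ × E} (hg : HasGradPair W τ ξ g) :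
    HasGradientAt (W τ) g.2 ξ := by
  rw [hasGradientAt_iff_hasFDerivAt]
  refine (HasFDerivAt.comp ξ hg (hasFDerivAt_prodMk_right τ ξ)).congr_fderiv ?_
  ext v
  simp

theorem valueFn_of_lt (hτ : T < τ) : valueFn F φ T τ ξ = sInf (range φ) := by
  have he : ∀ s, s ∉ Icc τ T := fun s hs => by linarith [hs.1, hs.2]
  unfold valueFn
  congr 1
  ext a
  constructor
  · rintro ⟨y, -, -, -, rfl⟩
    exact mem_range_self _
  · rintro ⟨v, rfl⟩
    refine ⟨fun s => if s = τ then ξ else v, 0, ⟨⟨intervalIntegrable_const, ?_, ?_⟩, ?_⟩, by simp,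
      by simp [hτ.ne]⟩
    · exact fun s hs => (he s hs).elim
    · exact .of_forall fun s hs => (he s hs).elim
    · exact .of_forall fun s hs => (he s hs).elim

/-- The value function is locally constant at times later than `T`. -/
theorem eq_zero_of_hasGradPair {g : ℝ × E} (hg : HasGradPair (valueFn F φ T) τ ξ g)
    (hτ : T ≤ τ) : g = 0 := by
  have key : ∀ v : E, g.1 + ⟪g.2, v⟫ = 0 := by
    intro v
    have hγ : HasDerivAt (fun θ : ℝ => (τ + θ, ξ + θ • v)) ((1 : ℝ), v) 0 := by
      refine ((hasDerivAt_id (0:ℝ)).const_add τ).prodMk ?_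
      simpa using ((hasDerivAt_id (0:ℝ)).smul_const v).const_add ξ
    have hg' := hg
    unfold HasGradPair at hg'
    have h1 := HasFDerivAt.comp_hasDerivAt (0:ℝ) (l := fun sy : ℝ × E => valueFn F φ T sy.1 sy.2)
      (f := fun θ : ℝ => (τ + θ, ξ + θ • v)) (by simpa only [add_zero, zero_smul] using hg') hγ
    have h2 : ∀ θ ∈ Ioi (0:ℝ), ((fun sy : ℝ × E => valueFn F φ T sy.1 sy.2) ∘
        fun θ : ℝ => (τ + θ, ξ + θ • v)) θ = sInf (range φ) := fun θ hθ =>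
      valueFn_of_lt (by simp only [mem_Ioi] at hθ; linarith)
    have h3 : ((fun sy : ℝ × E => valueFn F φ T sy.1 sy.2) ∘
        fun θ : ℝ => (τ + θ, ξ + θ • v)) 0 = sInf (range φ) :=
      tendsto_nhds_unique (h1.continuousAt.continuousWithinAt (s := Ioi 0))
        (tendsto_const_nhds.congr' (eventually_mem_nhdsWithin.mono fun θ hθ => (h2 θ hθ).symm))
    have h4 := (hasDerivWithinAt_const (0:ℝ) (Ioi 0) (sInf (range φ))).congr h2 h3
    simpa using (uniqueDiffWithinAt_Ioi (0:ℝ)).eq_deriv _ h1.hasDerivWithinAt h4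
  have h0 := key 0
  rw [inner_zero_right, add_zero] at h0
  have h1 := key g.2
  rw [h0, zero_add, inner_self_eq_zero] at h1
  exact Prod.ext h0 h1

theorem snd_ne_zero_of_mem_reachGradPair [FiniteDimensional ℝ E] (hSH : StandingHyp F)
    (hH1 : HypH1 F) (hφ : Continuous φ) {q : ℝ × E}
    (hq : q ∈ ReachGradPair (valueFn F φ T) t x) (hne : q ≠ 0) : q.2 ≠ 0 := by
  obtain ⟨u, g, hug, hu, hg⟩ := hq
  obtain ⟨r, hr, hgrow⟩ := hSH.2.2
  set R := Real.exp (r * (T - t + 1)) * (1 + (‖x‖ + 1)) with hRdef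
  obtain ⟨L, c, M, hB⟩ := exists_localBounds hSH hH1 (R := R) (by positivity)
  intro h0
  have hle : ∀ᶠ i in atTop, |(g i).1| ≤ M * ‖(g i).2‖ := by
    filter_upwards [hg.eventually_ne hne, hu.eventually (closedBall_mem_nhds _ one_pos)]
      with i hi hui
    replace hui : dist (u i) (t, x) ≤ 1 := hui
    rw [Prod.dist_eq, max_le_iff, Real.dist_eq, dist_eq_norm] at hui
    have hlt : (u i).1 < T := not_le.1 fun h => hi (eq_zero_of_hasGradPair (hug i) h)
    refine abs_fst_le_of_hasGradPair hSH.1 hB hr hgrow hφ hlt ?_ (hug i)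
    have h1 := norm_le_norm_add_norm_sub' (u i).2 x
    have h2 := (abs_le.1 hui.1).1
    rw [hRdef]
    gcongr <;> linarith [hui.2]
  have := le_of_tendsto_of_tendsto ((continuous_fst.tendsto _).comp hg).abs
    (((continuous_snd.tendsto _).comp hg).norm.const_mul M) hle
  rw [h0, norm_zero, mul_zero] at this
  exact hne (Prod.ext (abs_nonpos_iff.1 this) h0)

end ReachableGradient

section Main

variable {F : E → Set E} {φ : E → ℝ} {t T : ℝ} {x : E}

/-- On a degenerate time interval the conclusion only prescribes `y` and its derivative at one
point. -/
theorem exists_extremal_of_terminal (F : E → Set E) (φ : E → ℝ) (T : ℝ) (x q : E) :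
    ∃ y p p' : ℝ → E,
      (∀ s ∈ Icc T T, HasDerivAt y (gradpH F (y s) (p s)) s) ∧ ACArc T T p p' ∧
      (∀ᵐ s ∂volume, s ∈ Icc T T → -p' s ∈ FSub (fun z => Ham F z (p s)) (y s)) ∧
      y T = x ∧ p T = q ∧ IsOptimal F φ T T x y (fun s => gradpH F (y s) (p s)) := by
  have hd : ∀ s, HasDerivAt (fun s => x + (s - T) • gradpH F x q) (gradpH F x q) s := fun s => by
    simpa using (((hasDerivAt_id s).sub_const T).smul_const (gradpH F x q)).const_add x
  have hnull : ∀ p : ℝ → Prop, ∀ᵐ s ∂volume, s ∈ Icc T T → p s := fun p => by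
    filter_upwards [measure_eq_zero_iff_ae_notMem.1 (measure_singleton T)] with s hs hs'
    rw [Icc_self] at hs'
    exact (hs hs').elim
  refine ⟨fun s => x + (s - T) • gradpH F x q, fun _ => q, 0, ?_, ⟨by simp, ?_, hnull _⟩,
    hnull _, by simp, rfl, ⟨⟨by simp, ?_, hnull _⟩, hnull _⟩, by simp, ?_⟩
  · rintro s hs
    obtain rfl : s = T := by simpa using hs
    simpa using hd s
  · intro s _
    simp
  · intro s hs
    obtain rfl : s = T := by simpa using hs
    simp
  · intro z z' _ hz
    simp [hz]

/-- Given a non-terminal point and a nonzero reachable spatial gradient, discrete extremals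
starting near the point converge to an optimal Hamiltonian extremal. -/
theorem exists_extremal_of_mem_reachGradPair [FiniteDimensional ℝ E] (hSH : StandingHyp F)
    (hH1 : HypH1 F) (hφ : ContDiff ℝ 1 φ) (htT : t < T) {q : ℝ × E}
    (hq : q ∈ ReachGradPair (valueFn F φ T) t x) (hq0 : q.2 ≠ 0) :
    ∃ y p p' : ℝ → E,
      (∀ s ∈ Icc t T, HasDerivAt y (gradpH F (y s) (p s)) s) ∧ ACArc t T p p' ∧
      (∀ᵐ s ∂volume, s ∈ Icc t T → -p' s ∈ FSub (fun z => Ham F z (p s)) (y s)) ∧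
      y t = x ∧ p t = -q.2 ∧ IsOptimal F φ t T x y (fun s => gradpH F (y s) (p s)) := by
  obtain ⟨u, g, hug, hu, hg⟩ := hq
  have hF := hSH.1
  obtain ⟨r, hr, hgrow⟩ := hSH.2.2
  set ℓ := T - t + 1 with hℓ
  have hℓ0 : 0 < ℓ := by linarith
  set R' := Real.exp (r * ℓ) * (1 + (‖x‖ + 2)) with hR'
  obtain ⟨L, c, M, hB⟩ := exists_localBounds hSH hH1 (R := R' + 2) (by positivity)
  have hLc : 0 ≤ L + c := add_nonneg hB.L_nonneg hB.c_nonneg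
  set ε : ℕ → ℝ := fun i => min 1 (‖q.2‖ / 4) * (1 / ((i : ℝ) + 1)) with hε
  have hq2 : 0 < ‖q.2‖ := norm_pos_iff.2 hq0
  have hε0 : ∀ i, 0 < ε i := fun i => by positivity
  have hεle : ∀ i, ε i ≤ min 1 (‖q.2‖ / 4) := fun i =>
    mul_le_of_le_one_right (by positivity) ((div_le_one (by positivity)).2 (by simp))
  have hε1 : ∀ i, ε i ≤ 1 := fun i => (hεle i).trans (min_le_left _ _)
  have hε2 : ∀ i, ε i ≤ ‖q.2‖ / 4 := fun i => (hεle i).trans (min_le_right _ _)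
  have hεlim : Tendsto ε atTop (𝓝 0) := by
    simpa [hε] using
      (tendsto_one_div_add_atTop_nhds_zero_nat (𝕜 := ℝ)).const_mul (min 1 (‖q.2‖ / 4))
  have hstep : ∀ i : ℕ, ∃ τ ξ γ, τ < T ∧ |τ - t| ≤ ε i ∧ ‖ξ - x‖ ≤ ε i ∧ ‖γ - q.2‖ ≤ ε i ∧
      HasGradientAt (valueFn F φ T τ) γ ξ := by
    intro i
    obtain ⟨j, h1, h2, h3⟩ := ((hu.eventually (closedBall_mem_nhds _ (hε0 i))).and
      ((hg.eventually (closedBall_mem_nhds _ (hε0 i))).and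
        (((continuous_fst.tendsto _).comp hu).eventually (gt_mem_nhds htT)))).exists
    replace h1 : dist (u j) (t, x) ≤ ε i := h1
    replace h2 : dist (g j) q ≤ ε i := h2
    rw [Prod.dist_eq, max_le_iff, Real.dist_eq, dist_eq_norm] at h1
    rw [Prod.dist_eq, max_le_iff, dist_eq_norm (g j).2] at h2
    exact ⟨_, _, _, h3, h1.1, h1.2, h2.2, hasGradientAt_of_hasGradPair (hug j)⟩
  choose τ ξ γ hτT hτ hξ hγ hgrad using hstep
  have hτℓ : ∀ i, T - τ i ≤ ℓ := fun i => by
    linarith [(abs_le.1 (hτ i)).1, hε1 i]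
  have hξx : ∀ i, ‖ξ i‖ ≤ ‖x‖ + ε i := fun i => by
    linarith [norm_le_norm_add_norm_sub' (ξ i) x, hξ i]
  have hstart : ∀ i, Real.exp (r * (T - τ i)) * (1 + (‖ξ i‖ + 1)) < R' + 2 := by
    intro i
    have : Real.exp (r * (T - τ i)) * (1 + (‖ξ i‖ + 1)) ≤ R' := by
      rw [hR']
      gcongr ?_ * (1 + ?_)
      · exact Real.exp_le_exp.2 (mul_le_mul_of_nonneg_left (hτℓ i) hr.le)
      · linarith [hξx i, hε1 i]
    linarith
  choose N h z p hN hh hhε hhN hE hpN hmin hz0 hp0 using fun i =>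
    exists_isExtremal_near hF hB hr hgrow hφ (hτT i) (hstart i) (hgrad i) (hε0 i) (hε1 i) (hε0 i)
  have hz0x : ∀ i, ‖z i 0 - x‖ ≤ 2 * ε i := fun i => by
    linarith [norm_sub_le_norm_sub_add_norm_sub (z i 0) (ξ i) x, hz0 i, hξ i]
  have hp0q : ∀ i, ‖p i 0 + q.2‖ ≤ 2 * ε i := fun i => by
    have : p i 0 + q.2 = (p i 0 + γ i) - (γ i - q.2) := by abel
    rw [this]
    linarith [norm_sub_le (p i 0 + γ i) (γ i - q.2), hp0 i, hγ i]
  have hmesh : IsMesh t T h N := by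
    refine ⟨htT, hh, squeeze_zero (fun i => (hh i).le) (fun i => (hhε i).le) hεlim, ?_⟩
    simp only [hhN]
    refine tendsto_const_nhds.sub ?_
    rw [tendsto_iff_norm_sub_tendsto_zero]
    exact squeeze_zero (fun _ => norm_nonneg _) hτ hεlim
  have hbound : ∀ i ζ, IsEuler F (h i) (N i) ζ → ζ 0 = z i 0 → ∀ k ≤ N i, ‖ζ k‖ ≤ R' := by
    intro i ζ hζ hζ0 k hk
    refine (hζ.norm_le_exp (hh i).le hr hgrow ((hhN i).le.trans (hτℓ i)) k hk).trans ?_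
    rw [hζ0, hR']
    gcongr
    linarith [norm_le_norm_add_norm_sub' (z i 0) x, hz0x i, hε1 i]
  have hzR' : ∀ i, ∀ k ≤ N i, ‖z i k‖ ≤ R' := fun i => hbound i _ (hE i).isEuler rfl
  have hadj : ∀ i j k, j ≤ k → k ≤ N i → ‖p i j‖ ≤ Real.exp ((L + c) * ℓ) * ‖p i k‖ := by
    intro i j k hjk hk
    refine ((hE i).norm_adjoint_le hB (hh i).le (fun k hk => by linarith [hzR' i k hk])
      hjk hk).trans ?_
    have h1 : h i * ((k : ℝ) - j) ≤ h i * N i := by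
      have : (k : ℝ) ≤ N i := by exact_mod_cast hk
      exact mul_le_mul_of_nonneg_left (by linarith [j.cast_nonneg (α := ℝ)]) (hh i).le
    gcongr
    linarith [hhN i, hτℓ i]
  obtain ⟨G, hG⟩ := (isCompact_closedBall (0:E) R').exists_bound_of_continuousOn
    (f := gradient φ) ((InnerProductSpace.toDual ℝ E).symm.continuous.comp
      (hφ.continuous_fderiv one_ne_zero)).continuousOn
  have hpP : ∀ i, ∀ k ≤ N i, ‖p i k‖ ≤ Real.exp ((L + c) * ℓ) * G := by
    intro i k hk
    refine (hadj i k (N i) hk le_rfl).trans ?_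
    rw [hpN, norm_neg]
    gcongr
    exact hG _ (mem_closedBall_zero_iff.2 (hzR' i _ le_rfl))
  have hpm : ∀ i, ∀ k ≤ N i, (Real.exp ((L + c) * ℓ))⁻¹ * (‖q.2‖ / 2) ≤ ‖p i k‖ := by
    intro i k hk
    rw [inv_mul_le_iff₀ (Real.exp_pos _)]
    refine le_trans ?_ (hadj i 0 k (Nat.zero_le k) hk)
    have : ‖q.2‖ ≤ ‖p i 0 + q.2‖ + ‖p i 0‖ := by
      simpa using norm_sub_le (p i 0 + q.2) (p i 0)
    linarith [hp0q i, hε2 i]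
  obtain ⟨y, w, w', hy, hw, hw', hyt, hy0, hyT, hw0⟩ := exists_hamiltonian_limit hF hH1 hB hmesh hE
    (by linarith) hzR' hpP (by positivity) hpm
  have hε' : Tendsto (fun i => 2 * ε i) (hyperfilter ℕ) (𝓝 0) := by
    simpa using (hεlim.mono_left Nat.hyperfilter_le_atTop).const_mul 2
  have hyx : y t = x := tendsto_nhds_unique hy0 (tendsto_iff_norm_sub_tendsto_zero.2
    (squeeze_zero (fun _ => norm_nonneg _) hz0x hε'))
  have hwq : w t = -q.2 := tendsto_nhds_unique hw0 (tendsto_iff_norm_sub_tendsto_zero.2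
    (squeeze_zero (fun _ => norm_nonneg _) (fun i => by simpa using hp0q i) hε'))
  refine ⟨y, w, w', hy, hw, hw', hyx, hwq, hyt, hyx, fun η η' hη hη0 => ?_⟩
  have hηR : ∀ s ∈ Icc t T, ‖η s‖ ≤ R' + 2 := fun s hs =>
    isTraj_norm_le_exp hη htT.le hr hgrow (by
      have : Real.exp (r * (T - t)) * (1 + ‖η t‖) ≤ R' := by
        rw [hη0, hR']
        gcongr <;> linarith
      linarith) hs
  obtain ⟨ζ, hζ, hζ0, hζT⟩ := exists_isEuler_tendsto hF hB hmesh hN hη hηR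
    (w := fun i => z i 0) (by rwa [hη0, ← hyx])
    fun i ζ hζ hζ0 k hk => (hbound i ζ hζ hζ0 k hk).trans (by linarith)
  exact le_of_tendsto_of_tendsto' ((hφ.continuous.tendsto _).comp hyT)
    ((hφ.continuous.tendsto _).comp hζT) fun i => hmin i (ζ i) (hζ i) (hζ0 i)

end Main

end MayerProblem

/-- Lemma 5.1.
Under (SH), (H1), `φ ∈ C¹`, for `(t,x) ∈ [0,T]×ℝⁿ` and `p̄ = (p̄_t,p̄_x) ∈ ∂*V(t,x)∖{0}`,
there is a pair `(y,p)` on `[t,T]` with `y' = ∇ₚH(y,p)` everywhere,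
`−p' ∈ ∂ₓ⁻H(y,p)` a.e., `y(t)=x`, `p(t)=−p̄_x`, and `y` optimal for `P(t,x)`. -/
theorem stmt4 {n : ℕ} (F : Euc n → Set (Euc n)) (φ : Euc n → ℝ) (T : ℝ)
    (hSH : StandingHyp F) (hH1 : HypH1 F) (hφ : ContDiff ℝ 1 φ)
    (t : ℝ) (x : Euc n) (ht : t ∈ Icc (0:ℝ) T)
    (pbar : ℝ × Euc n) (hpbar : pbar ∈ ReachGradPair (valueFn F φ T) t x)
    (hne : pbar ≠ 0) :
    ∃ y p p' : ℝ → Euc n,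
      (∀ s ∈ Icc t T, HasDerivAt y (gradpH F (y s) (p s)) s) ∧
      ACArc t T p p' ∧
      (∀ᵐ s ∂volume, s ∈ Icc t T → -p' s ∈ FSub (fun z => Ham F z (p s)) (y s)) ∧
      y t = x ∧ p t = -pbar.2 ∧
      IsOptimal F φ t T x y (fun s => gradpH F (y s) (p s)) := by
  obtain rfl | htT := ht.2.eq_or_lt
  · exact MayerProblem.exists_extremal_of_terminal F φ t x (-pbar.2)
  · exact MayerProblem.exists_extremal_of_mem_reachGradPair hSH hH1 hφ htT hpbar
      (MayerProblem.snd_ne_zero_of_mem_reachGradPair hSH hH1 hφ.continuous hpbar hne)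

end
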